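/- Bound on the total influence: there exists a constant C > 0 such that for all real λ, Σ_{i≥1} ( E[ |Δ_i| ] )² ≤ C λ² E[ e^{2λ F_m} ] n^{(9−d)/8}. -/

import Mathlib

open MeasureTheory
open scoped ENNReal NNReal

attribute [local instance] Classical.propDecidable

noncomputable section

namespace Perco

/-- Vertices of the lattice `ℤ^d`. -/
abbrev ZVec (d : ℕ) := Fin d → ℤ

/-- The `ℓ¹` norm of a lattice point (as a natural number). -/
def norm1 (d : ℕ) (x : ZVec d) : ℕ := ∑ i, (x i).natAbs

/-- The `ℓ∞` norm of a lattice point (as a natural number). -/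
def normInf (d : ℕ) (x : ZVec d) : ℕ := Finset.univ.sup fun i => (x i).natAbs

/-- Nearest-neighbour edges of `ℤ^d`, each written `(x_e, y_e)` with `‖x_e‖₁ < ‖y_e‖₁`. -/
def EdgeD (d : ℕ) := {e : ZVec d × ZVec d // norm1 d (e.1 - e.2) = 1 ∧ norm1 d e.1 < norm1 d e.2}

/-- A percolation configuration: each edge is open (`true`) or closed (`false`). -/
abbrev Config (d : ℕ) := EdgeD d → Bool

/-- Adjacency in `ℤ^d`. -/
def Adj (d : ℕ) (x y : ZVec d) : Prop := norm1 d (x - y) = 1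

/-- A (self-avoiding, nearest-neighbour) path, recorded as its list of vertices. -/
def IsPath (d : ℕ) (γ : List (ZVec d)) : Prop :=
  γ ≠ [] ∧ γ.Nodup ∧ γ.Chain' (Adj d)

/-- The (unordered) edge `{x,y}` is open in the configuration `ω`. -/
def EdgeOpen (d : ℕ) (ω : Config d) (x y : ZVec d) : Prop :=
  ∃ e : EdgeD d, (e.val = (x, y) ∨ e.val = (y, x)) ∧ ω e = true

/-- All edges of the path are open. -/
def IsOpenPath (d : ℕ) (ω : Config d) (γ : List (ZVec d)) : Prop :=
  γ.Chain' (EdgeOpen d ω)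

/-- The (unordered) edge `{x,y}` is an edge of the path `γ`. -/
def edgeMemPath (d : ℕ) (x y : ZVec d) (γ : List (ZVec d)) : Prop :=
  (x, y) ∈ γ.zip γ.tail ∨ (y, x) ∈ γ.zip γ.tail

/-- Truncated FPP weight of the edge `{x,y}`: `1` if open, `log² n` if closed. -/
def pairWeight (d n : ℕ) (ω : Config d) (x y : ZVec d) : ℝ :=
  if EdgeOpen d ω x y then 1 else (Real.log n) ^ 2

/-- Total truncated weight of a path. -/
def pathCost (d n : ℕ) (ω : Config d) : List (ZVec d) → ℝ
  | [] => 0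
  | [_] => 0
  | x :: y :: rest => pairWeight d n ω x y + pathCost d n ω (y :: rest)

/-- Truncated first-passage time between `x` and `y`. -/
def passageTime (d n : ℕ) (ω : Config d) (x y : ZVec d) : ℝ :=
  sInf {c : ℝ | ∃ γ : List (ZVec d), IsPath d γ ∧ γ.head? = some x ∧
    γ.getLast? = some y ∧ pathCost d n ω γ = c}

/-- Chemical distance between `x` and `y` using only open paths inside `U`. -/
def chemDistIn (d : ℕ) (ω : Config d) (U : Set (ZVec d)) (x y : ZVec d) : ℕ∞ :=
  sInf {k : ℕ∞ | ∃ γ : List (ZVec d), IsPath d γ ∧ IsOpenPath d ω γ ∧ (∀ v ∈ γ, v ∈ U) ∧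
    γ.head? = some x ∧ γ.getLast? = some y ∧ ((γ.length - 1 : ℕ) : ℕ∞) = k}

/-- Chemical distance in the whole lattice. -/
def chemDist (d : ℕ) (ω : Config d) (x y : ZVec d) : ℕ∞ := chemDistIn d ω Set.univ x y

/-- `x` belongs to an infinite open cluster. -/
def InInfCluster (d : ℕ) (ω : Config d) (x : ZVec d) : Prop :=
  {y | chemDist d ω x y ≠ ⊤}.Infinite

/-- `x*`: a point of the infinite cluster at minimal `ℓ∞`-distance from `x`
(deterministic tie-breaking via choice); `x` itself if there is no infinite cluster. -/
def starPt (d : ℕ) (ω : Config d) (x : ZVec d) : ZVec d :=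
  if h : ∃ y, InInfCluster d ω y ∧ ∀ z, InInfCluster d ω z →
      normInf d (y - x) ≤ normInf d (z - x)
  then h.choose else x

/-- `μ` is the Bernoulli(p) bond-percolation product measure on configurations. -/
def IsBernoulli (d : ℕ) (p : ℝ) (μ : Measure (Config d)) : Prop :=
  IsProbabilityMeasure μ ∧
  ∀ (s : Finset (EdgeD d)) (f : EdgeD d → Bool),
    μ {ω | ∀ e ∈ s, ω e = f e} = ∏ e ∈ s, ENNReal.ofReal (if f e then p else 1 - p)

/-- The critical parameter of Bernoulli bond percolation on `ℤ^d`. -/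
def pc (d : ℕ) : ℝ :=
  sSup {p : ℝ | 0 ≤ p ∧ p ≤ 1 ∧ ∀ μ : Measure (Config d), IsBernoulli d p μ →
    μ {ω | ∃ x, InInfCluster d ω x} = 0}

/-- The point `n·e₁`. -/
def ptE1 (d n : ℕ) : ZVec d := fun i => if (i : ℕ) = 0 then (n : ℤ) else 0

/-- `D*_n = D(0*, (n e₁)*)`, as a real number. -/
def DstarR (d n : ℕ) (ω : Config d) : ℝ :=
  ((chemDist d ω (starPt d ω 0) (starPt d ω (ptE1 d n))).toNat : ℝ)

/-- `T_n = T(0, n e₁)`, the truncated passage time. -/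
def TnR (d n : ℕ) (ω : Config d) : ℝ := passageTime d n ω 0 (ptE1 d n)

/-- The box `Λ_t(z)` with integer radius. -/
def boxZ (d : ℕ) (t : ℕ) (z : ZVec d) : Set (ZVec d) := {y | normInf d (y - z) ≤ t}

/-- The box `Λ_t(z)` with real radius. -/
def boxR (d : ℕ) (t : ℝ) (z : ZVec d) : Set (ZVec d) := {y | (normInf d (y - z) : ℝ) ≤ t}

/-- The annulus `A_N(e) = Λ_{3N}(e) \ Λ_N(e)`. -/
def annulus (d : ℕ) (N : ℕ) (e : EdgeD d) : Set (ZVec d) :=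
  {y | normInf d (y - e.val.1) ≤ 3 * N ∧ N < normInf d (y - e.val.1)}

/-- `π` is a geodesic of the truncated passage time between its endpoints, inside `A`. -/
def IsGeodesicIn (d n : ℕ) (ω : Config d) (A : Set (ZVec d)) (π : List (ZVec d)) : Prop :=
  IsPath d π ∧ (∀ v ∈ π, v ∈ A) ∧
  ∀ π' : List (ZVec d), IsPath d π' → (∀ v ∈ π', v ∈ A) →
    π'.head? = π.head? → π'.getLast? = π.getLast? →
    pathCost d n ω π ≤ pathCost d n ω π'

/-- `γ ∈ 𝔾_*(A)`: a path in `A` obtained from some geodesic in `A` by replacing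
segments by open paths (all edges of `γ` not on the geodesic are open). -/
def GstarIn (d n : ℕ) (ω : Config d) (A : Set (ZVec d)) (γ : List (ZVec d)) : Prop :=
  IsPath d γ ∧ (∀ v ∈ γ, v ∈ A) ∧
  ∃ π : List (ZVec d), IsGeodesicIn d n ω A π ∧
    ∀ x y, edgeMemPath d x y γ → ¬ edgeMemPath d x y π → EdgeOpen d ω x y

/-- `γ` is a crossing path of the annulus `A_N(e)`. -/
def IsCrossing (d : ℕ) (N : ℕ) (e : EdgeD d) (γ : List (ZVec d)) : Prop :=
  IsPath d γ ∧ (∀ v ∈ γ, v ∈ annulus d N e) ∧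
  (∃ v ∈ γ, normInf d (v - e.val.1) = N + 1) ∧ (∃ v ∈ γ, normInf d (v - e.val.1) = 3 * N)

/-- The event `𝒱¹_N(e)`: any two modified geodesics crossing `A_N(e)` are linked by an
open path inside `A_N(e)` of length at most `C_* N`. -/
def V1 (d : ℕ) (Cstar : ℝ) (n : ℕ) (e : EdgeD d) (N : ℕ) (ω : Config d) : Prop :=
  ∀ γ1 γ2 : List (ZVec d),
    GstarIn d n ω (boxR d (Cstar * N) e.val.1) γ1 → IsCrossing d N e γ1 →
    GstarIn d n ω (boxR d (Cstar * N) e.val.1) γ2 → IsCrossing d N e γ2 →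
    ∃ π : List (ZVec d), IsPath d π ∧ IsOpenPath d ω π ∧ (∀ v ∈ π, v ∈ annulus d N e) ∧
      (∃ u, π.head? = some u ∧ u ∈ γ1) ∧ (∃ v, π.getLast? = some v ∧ v ∈ γ2) ∧
      ((π.length : ℝ) - 1 ≤ Cstar * N)

/-- The event `𝒱²_N(e)`: points of `Λ_{3N}(e)` openly connected inside `Λ_{3N}(e)` are
connected inside `Λ_{4N}(e)` by an open path of length at most `C_* N`. -/
def V2 (d : ℕ) (Cstar : ℝ) (e : EdgeD d) (N : ℕ) (ω : Config d) : Prop :=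
  ∀ x y : ZVec d, x ∈ boxZ d (3 * N) e.val.1 → y ∈ boxZ d (3 * N) e.val.1 →
    (∃ γ, IsPath d γ ∧ IsOpenPath d ω γ ∧ (∀ v ∈ γ, v ∈ boxZ d (3 * N) e.val.1) ∧
      γ.head? = some x ∧ γ.getLast? = some y) →
    ∃ γ, IsPath d γ ∧ IsOpenPath d ω γ ∧ (∀ v ∈ γ, v ∈ boxZ d (4 * N) e.val.1) ∧
      γ.head? = some x ∧ γ.getLast? = some y ∧ ((γ.length : ℝ) - 1 ≤ Cstar * N)

/-- The effective radius `R_e` as a natural number (`0` when undefined). -/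
def ReffN (d : ℕ) (Cstar : ℝ) (n : ℕ) (e : EdgeD d) (ω : Config d) : ℕ :=
  sInf {N : ℕ | 1 ≤ N ∧ V1 d Cstar n e N ω ∧ V2 d Cstar e N ω}

/-- The effective radius `R_e`, valued in `ℝ≥0∞` (`∞` when undefined). -/
def ReffENN (d : ℕ) (Cstar : ℝ) (n : ℕ) (e : EdgeD d) (ω : Config d) : ℝ≥0∞ :=
  sInf {r : ℝ≥0∞ | ∃ N : ℕ, r = N ∧ 1 ≤ N ∧ V1 d Cstar n e N ω ∧ V2 d Cstar e N ω}

/-- The truncated effective radius `R̂_e = min (C_* R_e) (log² n)`. -/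
def RhatR (d : ℕ) (Cstar : ℝ) (n : ℕ) (e : EdgeD d) (ω : Config d) : ℝ :=
  (min (ENNReal.ofReal Cstar * ReffENN d Cstar n e ω)
    (ENNReal.ofReal ((Real.log n) ^ 2))).toReal

/-- `diam(γ) ≥ r`. -/
def DiamGE (d : ℕ) (γ : List (ZVec d)) (r : ℝ) : Prop :=
  ∃ i : Fin d, ∃ x ∈ γ, ∃ y ∈ γ, r ≤ |((x i : ℤ) : ℝ) - ((y i : ℤ) : ℝ)|

/-- The boundary `∂Λ_t` (real radius `t`). -/
def bdryR (d : ℕ) (t : ℝ) : Set (ZVec d) :=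
  {x | (normInf d x : ℝ) ≤ t ∧ t - 1 < (normInf d x : ℝ)}

/-- The slab `S(ℓ,t) = {x ∈ Λ_t : 0 ≤ x₁ ≤ ℓ}`. -/
def slab (d : ℕ) (l t : ℝ) : Set (ZVec d) :=
  {x | (normInf d x : ℝ) ≤ t ∧ ∀ i : Fin d, (i : ℕ) = 0 → 0 ≤ x i ∧ ((x i : ℤ) : ℝ) ≤ l}

/-- The open cluster of the vertex `v`. -/
def openClusterOf (d : ℕ) (ω : Config d) (v : ZVec d) : Set (ZVec d) :=
  {y | chemDist d ω v y ≠ ⊤}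

/-- The set `C` crosses the box `Λ_t(z)`: in each direction an open path of `C ∩ Λ_t(z)`
connects the two opposite faces. -/
def CrossesBox (d : ℕ) (ω : Config d) (C : Set (ZVec d)) (t : ℕ) (z : ZVec d) : Prop :=
  ∀ i : Fin d, ∃ γ, IsPath d γ ∧ IsOpenPath d ω γ ∧ (∀ u ∈ γ, u ∈ C ∧ u ∈ boxZ d t z) ∧
    (∃ u ∈ γ, u i = z i - t) ∧ (∃ u ∈ γ, u i = z i + t)

/-- The event `𝓔_N`: some crossing open cluster of `Λ_{2N}` is avoided by a modified
geodesic `π ⊆ Λ_N` of diameter at least `N/2` belonging to `𝔾_*(Λ_{tN})`. -/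
def ENevent (d n : ℕ) (t : ℝ) (N : ℕ) : Set (Config d) :=
  {ω | ∃ v0 : ZVec d, CrossesBox d ω (openClusterOf d ω v0) (2 * N) 0 ∧
    ∃ π : List (ZVec d), IsPath d π ∧ (∀ u ∈ π, u ∈ boxZ d N 0) ∧
      GstarIn d n ω (boxR d (t * N) 0) π ∧ DiamGE d π ((N : ℝ) / 2) ∧
      ∀ u ∈ π, u ∉ openClusterOf d ω v0}

/-- `ρ` is a Garet–Marchand moderate-deviation constant for the chemical distance. -/
def GMprop (d : ℕ) (μ : Measure (Config d)) (ρ : ℝ) : Prop :=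
  1 ≤ ρ ∧ ∃ c : ℝ, 0 < c ∧ ∀ x : ZVec d, ∀ t : ℝ, ρ * (normInf d x : ℝ) ≤ t →
    μ {ω | chemDist d ω 0 x ≠ ⊤ ∧ t ≤ ((chemDist d ω 0 x).toNat : ℝ)}
      ≤ ENNReal.ofReal (c⁻¹ * Real.exp (-c * t)) ∧
    μ {ω | t ≤ ((chemDist d ω (starPt d ω 0) (starPt d ω x)).toNat : ℝ) ∨
        chemDist d ω (starPt d ω 0) (starPt d ω x) = ⊤}
      ≤ ENNReal.ofReal (c⁻¹ * Real.exp (-c * t))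

/-- `cs` is a constant for which the crossing-cluster avoidance lemma holds. -/
def CrossProp (d : ℕ) (μ : Measure (Config d)) (cs : ℝ) : Prop :=
  0 < cs ∧ cs < 1 ∧ ∀ n : ℕ, 2 ≤ n → ∀ t : ℝ, 1 / cs ≤ t → ∀ N : ℕ, 1 ≤ N →
    (N : ℝ) ≤ Real.exp (cs * (Real.log n) ^ 2) →
    μ (ENevent d n t N) ≤ ENNReal.ofReal (cs⁻¹ * Real.exp (-cs * N))

/-- `N_ρ = ⌊N / (16 ρ²)⌋`. -/
def Nrho (ρ : ℝ) (N : ℕ) : ℕ := Nat.floor ((N : ℝ) / (16 * ρ ^ 2))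

/-- The cube of side-length `m` with lower corner `z`. -/
def cube (d : ℕ) (m : ℕ) (z : ZVec d) : Set (ZVec d) :=
  {y | ∀ i, z i ≤ y i ∧ y i ≤ z i + m}

/-- The open cluster of `v` inside `U`. -/
def clusterIn (d : ℕ) (ω : Config d) (U : Set (ZVec d)) (v : ZVec d) : Set (ZVec d) :=
  {y | chemDistIn d ω U v y ≠ ⊤}

/-- `k ≤ r` for `k : ℕ∞` and `r : ℝ` (in particular `k` is finite). -/
def chemLE (k : ℕ∞) (r : ℝ) : Prop := ∃ m : ℕ, k = (m : ℕ∞) ∧ (m : ℝ) ≤ r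

/-- The box `Λ_{3N}(e)` is good (Definition 2.2 of the paper). -/
def GoodBox (d n : ℕ) (ρ Cstar : ℝ) (e : EdgeD d) (N : ℕ) (ω : Config d) : Prop :=
  (∃ v0 ∈ boxZ d (3 * N) e.val.1,
    (∀ z : ZVec d, cube d (Nrho ρ N) z ⊆ boxZ d (3 * N) e.val.1 →
      ∀ i : Fin d, ∃ γ, IsPath d γ ∧ IsOpenPath d ω γ ∧
        (∀ u ∈ γ, u ∈ clusterIn d ω (boxZ d (3 * N) e.val.1) v0 ∧ u ∈ cube d (Nrho ρ N) z) ∧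
        (∃ u ∈ γ, u i = z i) ∧ (∃ u ∈ γ, u i = z i + (Nrho ρ N : ℤ))) ∧
    (∀ π, IsPath d π → (∀ u ∈ π, u ∈ boxZ d (3 * N) e.val.1) →
      GstarIn d n ω (boxR d (Cstar * N) e.val.1) π → DiamGE d π ((Nrho ρ N : ℝ)) →
      ∃ u ∈ π, u ∈ clusterIn d ω (boxZ d (3 * N) e.val.1) v0)) ∧
  (∀ x y : ZVec d, x ∈ boxZ d (3 * N) e.val.1 → y ∈ boxZ d (3 * N) e.val.1 →
    normInf d (x - y) ≤ 2 * Nrho ρ N → chemDist d ω x y ≠ ⊤ →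
    chemDistIn d ω (boxZ d (4 * N) e.val.1) x y = chemDist d ω x y ∧
    chemLE (chemDist d ω x y) (4 * ρ * (Nrho ρ N : ℝ))) ∧
  (∀ x y : ZVec d, x ∈ annulus d N e → y ∈ annulus d N e →
    (∀ b : ZVec d, (normInf d (b - e.val.1) = N ∨ normInf d (b - e.val.1) = 3 * N) →
      (N : ℝ) / 2 ≤ (normInf d (x - b) : ℝ) ∧ (N : ℝ) / 2 ≤ (normInf d (y - b) : ℝ)) →
    normInf d (x - y) ≤ 2 * Nrho ρ N → chemDist d ω x y ≠ ⊤ →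
    chemDistIn d ω (annulus d N e) x y = chemDist d ω x y ∧
    chemLE (chemDist d ω x y) (4 * ρ * (Nrho ρ N : ℝ)))

/-- Evaluate an edge-indexed function at the (unordered) pair `{x,y}`, `0` if not an edge. -/
def edgeFnVal (d : ℕ) (g : EdgeD d → ℝ) (x y : ZVec d) : ℝ :=
  if h : ∃ e : EdgeD d, e.val = (x, y) ∨ e.val = (y, x) then g h.choose else 0

/-- The sum of `g` over the edges of the path `γ`. -/
def pathSum (d : ℕ) (g : EdgeD d → ℝ) (γ : List (ZVec d)) : ℝ :=
  ((γ.zip γ.tail).map fun pr => edgeFnVal d g pr.1 pr.2).sum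

/-- Number of edges of `η` that are not edges of `γ`, i.e. `|η \ γ|`. -/
def diffEdgeCount (d : ℕ) (η γ : List (ZVec d)) : ℕ :=
  ((η.zip η.tail).filter fun pr => decide (¬ edgeMemPath d pr.1 pr.2 γ)).length

/-- Maximal total weight of a lattice animal (path) in `Ξ_L`. -/
def animalMax (d : ℕ) (L : ℕ) (g : EdgeD d → ℝ) : ℝ :=
  sSup {r : ℝ | ∃ γ : List (ZVec d), IsPath d γ ∧ (∀ v ∈ γ, v ∈ boxZ d L 0) ∧
    γ.length ≤ L + 1 ∧ r = pathSum d g γ}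

/-- `m = ⌊n^{1/4}⌋`. -/
def mOf (n : ℕ) : ℕ := Nat.floor ((n : ℝ) ^ ((1 : ℝ) / 4))

/-- The box `Λ_m` as a finite set. -/
def boxFinset (d m : ℕ) : Finset (ZVec d) := Finset.Icc (fun _ => -(m : ℤ)) (fun _ => (m : ℤ))

/-- The spatially averaged passage time `F_m`. -/
def Fm (d n : ℕ) (ω : Config d) : ℝ :=
  (∑ z ∈ boxFinset d (mOf n), passageTime d n ω z (z + ptE1 d n)) / (boxFinset d (mOf n)).card

/-- The σ-algebra generated by the states of the first `i` edges. -/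
def edgeFiltration (d : ℕ) (ε : ℕ ≃ EdgeD d) (i : ℕ) : MeasurableSpace (Config d) :=
  MeasurableSpace.comap (fun ω (j : Fin i) => ω (ε j)) MeasurableSpace.pi

/-- The martingale increment `Δ_i = E[e^{λ F_m} | 𝓕_i] − E[e^{λ F_m} | 𝓕_{i−1}]`. -/
def mgDelta (d n : ℕ) (ε : ℕ ≃ EdgeD d) (lam : ℝ) (μ : Measure (Config d)) (i : ℕ) :
    Config d → ℝ :=
  fun ω => (μ[fun ω' => Real.exp (lam * Fm d n ω') | edgeFiltration d ε i]) ω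
    - (μ[fun ω' => Real.exp (lam * Fm d n ω') | edgeFiltration d ε (i - 1)]) ω

/-- The entropy `Ent[X] = E[X log (X / E[X])]`. -/
def entOf {α : Type*} [MeasurableSpace α] (μ : Measure α) (X : α → ℝ) : ℝ :=
  ∫ ω, X ω * Real.log (X ω / ∫ ω', X ω' ∂μ) ∂μ

end Perco
namespace Perco

/-- The configuration `ω` with the state of the edge `e` replaced by `b`. -/
abbrev setEdge {d : ℕ} (ω : Config d) (e : EdgeD d) (b : Bool) : Config d := Function.update ω e b

theorem measurable_setEdge {d : ℕ} (e : EdgeD d) (b : Bool) :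
    Measurable fun ω : Config d => setEdge ω e b :=
  measurable_pi_lambda _ fun e' => by
    by_cases h : e' = e
    · subst h; simp
    · simpa [setEdge, Function.update_of_ne h] using measurable_pi_apply e'

@[simp] theorem setEdge_self {d : ℕ} (ω : Config d) (e : EdgeD d) (b : Bool) :
    setEdge ω e b e = b := Function.update_self ..

theorem setEdge_of_ne {d : ℕ} (ω : Config d) {e e' : EdgeD d} (h : e' ≠ e) (b : Bool) :
    setEdge ω e b e' = ω e' := Function.update_of_ne h ..

theorem measurable_of_dependsOn {d : ℕ} {β : Type*} [MeasurableSpace β] {f : Config d → β}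
    {B : Finset (EdgeD d)} (hf : DependsOn f (B : Set (EdgeD d))) : Measurable f := by
  have : f = (fun η : B → Bool => f fun e => if h : e ∈ B then η ⟨e, h⟩ else true) ∘
      fun ω (e : B) => ω e := by
    funext ω
    refine hf fun e he => ?_
    have he' : e ∈ B := he
    simp [he']
  rw [this]
  exact (measurable_of_finite _).comp (measurable_pi_lambda _ fun e => measurable_pi_apply _)

theorem exists_bound_of_dependsOn {d : ℕ} {f : Config d → ℝ}
    {B : Finset (EdgeD d)} (hf : DependsOn f (B : Set (EdgeD d))) : ∃ C, ∀ ω, |f ω| ≤ C := by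
  let g : (B → Bool) → ℝ := fun η => f fun e => if h : e ∈ B then η ⟨e, h⟩ else true
  obtain ⟨C, hC⟩ := (Set.finite_range fun η => |g η|).bddAbove
  refine ⟨C, fun ω => ?_⟩
  have : f ω = g fun e => ω e := by
    refine hf fun e he => ?_
    have he' : e ∈ B := he
    simp [he']
  rw [this]
  exact hC (Set.mem_range_self (f := fun η => |g η|) fun e : B => ω e)

theorem integrable_of_dependsOn {d : ℕ} {μ : Measure (Config d)} [IsFiniteMeasure μ]
    {f : Config d → ℝ} {B : Finset (EdgeD d)} (hf : DependsOn f (B : Set (EdgeD d))) :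
    Integrable f μ := by
  obtain ⟨C, hC⟩ := exists_bound_of_dependsOn hf
  exact Integrable.of_bound (measurable_of_dependsOn hf).aestronglyMeasurable C
    (Filter.Eventually.of_forall hC)

theorem IsBernoulli.unique {d : ℕ} {p : ℝ} {μ ν : Measure (Config d)}
    (hμ : IsBernoulli d p μ) (hν : IsBernoulli d p ν) : μ = ν := by
  have := hμ.1
  have := hν.1
  refine IsProjectiveLimit.unique (P := fun I => μ.map I.restrict) (fun I => rfl) fun I => ?_
  refine Measure.ext_of_singleton fun η => ?_
  have hs : (I.restrict : Config d → I → Bool) ⁻¹' {η} =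
      {ω : Config d | ∀ e ∈ I, ω e = if h : e ∈ I then η ⟨e, h⟩ else true} := by
    ext ω
    simp only [Set.mem_preimage, Set.mem_singleton_iff, funext_iff, Subtype.forall,
      Finset.restrict, Set.mem_ofPred_eq]
    refine forall₂_congr fun e he => ?_
    simp [he]
  have hm : Measurable (I.restrict : Config d → _) := Finset.measurable_restrict I
  rw [Measure.map_apply hm (measurableSet_singleton _),
    Measure.map_apply hm (measurableSet_singleton _), hs]
  exact (hν.2 I fun e => if h : e ∈ I then η ⟨e, h⟩ else true).trans
    (hμ.2 I fun e => if h : e ∈ I then η ⟨e, h⟩ else true).symm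

theorem measurableSet_cylinder {d : ℕ} (s : Finset (EdgeD d)) (f : EdgeD d → Bool) :
    MeasurableSet {ω : Config d | ∀ e ∈ s, ω e = f e} := by
  have : {ω : Config d | ∀ e ∈ s, ω e = f e} = ⋂ e ∈ s, (fun ω => ω e) ⁻¹' {f e} := by
    ext ω; simp
  rw [this]
  exact Finset.measurableSet_biInter s fun e _ =>
    measurable_pi_apply e (measurableSet_singleton _)

theorem IsBernoulli.resample {d : ℕ} {p : ℝ} {μ : Measure (Config d)}
    (hμ : IsBernoulli d p μ) (hp0 : 0 ≤ p) (hp1 : p ≤ 1) (e : EdgeD d) :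
    ENNReal.ofReal p • μ.map (fun ω => setEdge ω e true) +
      ENNReal.ofReal (1 - p) • μ.map (fun ω => setEdge ω e false) = μ := by
  have key : ∀ (s : Finset (EdgeD d)) (f : EdgeD d → Bool) (b : Bool),
      μ.map (fun ω => setEdge ω e b) {ω | ∀ e ∈ s, ω e = f e} =
        if e ∈ s ∧ f e ≠ b then 0
        else ∏ e ∈ s.erase e, ENNReal.ofReal (if f e then p else 1 - p) := by
    intro s f b
    rw [Measure.map_apply (measurable_setEdge e b) (measurableSet_cylinder s f)]
    split_ifs with h
    · convert measure_empty (μ := μ)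
      ext ω
      simp only [Set.mem_preimage, Set.mem_ofPred_eq, Set.mem_empty_iff_false, iff_false]
      intro h'
      have := h' e h.1
      simp at this
      exact h.2 this.symm
    · rw [← hμ.2]
      congr 1
      ext ω
      simp only [Set.mem_preimage, Set.mem_ofPred_eq, Finset.mem_erase]
      constructor
      · intro h' e' he'
        have := h' e' he'.2
        rwa [setEdge_of_ne _ he'.1] at this
      · intro h' e' he'
        by_cases hee : e' = e
        · subst hee
          push Not at h
          simp [h he']
        · rw [setEdge_of_ne _ hee]
          exact h' e' ⟨hee, he'⟩
  have hsum : ENNReal.ofReal p + ENNReal.ofReal (1 - p) = 1 := by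
    rw [← ENNReal.ofReal_add hp0 (by linarith)]
    simp
  refine IsBernoulli.unique ⟨⟨?_⟩, fun s f => ?_⟩ hμ
  · have := hμ.1
    have h1 : ∀ b, μ.map (fun ω => setEdge ω e b) Set.univ = 1 := fun b => by
      rw [Measure.map_apply (measurable_setEdge e b) MeasurableSet.univ]
      simp
    simp only [Measure.add_apply, Measure.smul_apply, h1, smul_eq_mul, mul_one, hsum]
  · simp only [Measure.add_apply, Measure.smul_apply, smul_eq_mul, key]
    by_cases he : e ∈ s
    · rw [← Finset.mul_prod_erase s _ he]
      cases hb : f e <;> simp [he]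
    · simp only [he, false_and, if_false, ← add_mul, hsum, one_mul]
      rw [Finset.erase_eq_of_notMem he]

theorem IsBernoulli.integral_resample {d : ℕ} {p : ℝ} {μ : Measure (Config d)}
    (hμ : IsBernoulli d p μ) (hp0 : 0 ≤ p) (hp1 : p ≤ 1) (e : EdgeD d) {ψ : Config d → ℝ}
    (hm : Measurable ψ) (hb : ∃ C, ∀ ω, |ψ ω| ≤ C) :
    ∫ ω, ψ ω ∂μ = ∫ ω, (p * ψ (setEdge ω e true) + (1 - p) * ψ (setEdge ω e false)) ∂μ := by
  have := hμ.1
  obtain ⟨C, hC⟩ := hb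
  have hint : ∀ ν : Measure (Config d), IsFiniteMeasure ν → Integrable ψ ν := fun ν _ =>
    Integrable.of_bound hm.aestronglyMeasurable C (Filter.Eventually.of_forall hC)
  have hint' : ∀ b, Integrable (fun ω => ψ (setEdge ω e b)) μ := fun b =>
    Integrable.of_bound (hm.comp (measurable_setEdge e b)).aestronglyMeasurable C
      (Filter.Eventually.of_forall fun ω => hC _)
  conv_lhs => rw [← hμ.resample hp0 hp1 e]
  rw [integral_add_measure, integral_smul_measure, integral_smul_measure,
    integral_map (measurable_setEdge e _).aemeasurable hm.aestronglyMeasurable,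
    integral_map (measurable_setEdge e _).aemeasurable hm.aestronglyMeasurable,
    integral_add ((hint' _).const_mul _) ((hint' _).const_mul _),
    integral_const_mul, integral_const_mul, ENNReal.toReal_ofReal hp0,
    ENNReal.toReal_ofReal (by linarith)]
  · rfl
  · exact (hint _ inferInstance).smul_measure ENNReal.ofReal_ne_top
  · exact (hint _ inferInstance).smul_measure ENNReal.ofReal_ne_top

theorem IsBernoulli.map_comp_equiv {d : ℕ} {p : ℝ} {μ : Measure (Config d)}
    (hμ : IsBernoulli d p μ) (σ : EdgeD d ≃ EdgeD d) :
    μ.map (fun ω => ω ∘ σ) = μ := by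
  have := hμ.1
  have hm : Measurable fun ω : Config d => ω ∘ σ :=
    measurable_pi_lambda _ fun e => measurable_pi_apply _
  refine IsBernoulli.unique ⟨Measure.isProbabilityMeasure_map hm.aemeasurable, fun s f => ?_⟩ hμ
  rw [Measure.map_apply hm (measurableSet_cylinder s f)]
  have := hμ.2 (s.map σ.toEmbedding) (f ∘ σ.symm)
  rw [Finset.prod_map] at this
  simp only [Function.comp_apply, Equiv.coe_toEmbedding, Equiv.symm_apply_apply] at this
  rw [← this]
  congr 1
  ext ω
  simp only [Set.mem_preimage, Set.mem_ofPred_eq, Function.comp_apply, Finset.forall_mem_map,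
    Equiv.coe_toEmbedding, Equiv.symm_apply_apply]

theorem measurableSet_edgeFiltration_iff {d : ℕ} (ε : ℕ ≃ EdgeD d) (i : ℕ) (A : Set (Config d)) :
    MeasurableSet[edgeFiltration d ε i] A ↔
      ∀ ω ω' : Config d, (∀ j < i, ω (ε j) = ω' (ε j)) → ω ∈ A → ω' ∈ A := by
  constructor
  · rintro ⟨A', -, rfl⟩ ω ω' h hω
    have : (fun j : Fin i => ω (ε j)) = fun j : Fin i => ω' (ε j) := funext fun j => h j j.2
    simpa only [Set.mem_preimage, this] using hω
  · intro h
    refine ⟨(fun ω (j : Fin i) => ω (ε j)) '' A, (Set.toFinite _).measurableSet, ?_⟩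
    ext ω
    constructor
    · rintro ⟨ω', hω', he⟩
      exact h ω' ω (fun j hj => congrFun he ⟨j, hj⟩) hω'
    · exact fun hω => ⟨ω, hω, rfl⟩

theorem edgeFiltration_le {d : ℕ} (ε : ℕ ≃ EdgeD d) (i : ℕ) :
    edgeFiltration d ε i ≤ MeasurableSpace.pi :=
  Measurable.comap_le (measurable_pi_lambda _ fun _ => measurable_pi_apply _)

theorem edgeFiltration_mono {d : ℕ} (ε : ℕ ≃ EdgeD d) (i : ℕ) :
    edgeFiltration d ε i ≤ edgeFiltration d ε (i + 1) := fun A hA => by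
  rw [measurableSet_edgeFiltration_iff] at hA ⊢
  exact fun ω ω' h => hA ω ω' fun j hj => h j (by omega)

theorem dependsOn_of_measurable_edgeFiltration {d : ℕ} (ε : ℕ ≃ EdgeD d) (i : ℕ)
    {h : Config d → ℝ} (hm : Measurable[edgeFiltration d ε i] h) :
    DependsOn h (((Finset.range i).map ε.toEmbedding : Finset (EdgeD d)) : Set (EdgeD d)) := by
  intro ω ω' hω
  have := hm (measurableSet_singleton (h ω))
  rw [measurableSet_edgeFiltration_iff] at this
  refine (this ω ω' (fun j hj => hω _ ?_) rfl).symm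
  simpa using hj

/-- Averaging over the state of a single edge. -/
def resampleMean {d : ℕ} (p : ℝ) (e : EdgeD d) (G : Config d → ℝ) (ω : Config d) : ℝ :=
  p * G (setEdge ω e true) + (1 - p) * G (setEdge ω e false)

theorem dependsOn_setEdge {d : ℕ} {β : Type*} {G : Config d → β} {B : Set (EdgeD d)}
    (hG : DependsOn G B) (e : EdgeD d) (b : Bool) : DependsOn (fun ω => G (setEdge ω e b)) B := by
  intro ω ω' h
  refine hG fun e' he' => ?_
  by_cases hee : e' = e
  · subst hee; simp
  · rw [setEdge_of_ne _ hee, setEdge_of_ne _ hee, h e' he']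

theorem dependsOn_resampleMean {d : ℕ} {p : ℝ} {e : EdgeD d} {G : Config d → ℝ}
    {B : Set (EdgeD d)} (hG : DependsOn G B) : DependsOn (resampleMean p e G) B := by
  intro ω ω' h
  have key : ∀ b, G (setEdge ω e b) = G (setEdge ω' e b) := fun b => dependsOn_setEdge hG e b h
  simp only [resampleMean, key]

theorem setEdge_setEdge {d : ℕ} (ω : Config d) (e : EdgeD d) (b b' : Bool) :
    setEdge (setEdge ω e b) e b' = setEdge ω e b' := Function.update_idem ..

theorem IsBernoulli.integral_resampleMean {d : ℕ} {p : ℝ} {μ : Measure (Config d)}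
    (hμ : IsBernoulli d p μ) (hp0 : 0 ≤ p) (hp1 : p ≤ 1) (e : EdgeD d) {ψ : Config d → ℝ}
    {B : Finset (EdgeD d)} (hψ : DependsOn ψ (B : Set (EdgeD d))) :
    ∫ ω, ψ ω ∂μ = ∫ ω, resampleMean p e ψ ω ∂μ :=
  hμ.integral_resample hp0 hp1 e (measurable_of_dependsOn hψ) (exists_bound_of_dependsOn hψ)

theorem dependsOn_indicator {d : ℕ} {A : Set (Config d)} {G : Config d → ℝ}
    {B B' : Finset (EdgeD d)} (hA : ∀ ω ω' : Config d, (∀ e ∈ B, ω e = ω' e) → ω ∈ A → ω' ∈ A)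
    (hG : DependsOn G (B' : Set (EdgeD d))) :
    DependsOn (A.indicator G) ((B ∪ B' : Finset (EdgeD d)) : Set (EdgeD d)) := by
  intro ω ω' h
  have hG' := hG (x := ω) (y := ω') fun e he => h e (by simp_all)
  have h1 := hA ω ω' fun e he => h e (by simp_all)
  have h2 := hA ω' ω fun e he => (h e (by simp_all)).symm
  by_cases hω : ω ∈ A
  · simp [hω, h1 hω, hG']
  · have : ω' ∉ A := fun h' => hω (h2 h')
    simp [hω, this]

theorem IsBernoulli.condExp_resampleMean {d : ℕ} {p : ℝ} {μ : Measure (Config d)}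
    (hμ : IsBernoulli d p μ) (hp0 : 0 ≤ p) (hp1 : p ≤ 1) (ε : ℕ ≃ EdgeD d) (i : ℕ)
    {G : Config d → ℝ} {B : Finset (EdgeD d)} (hG : DependsOn G (B : Set (EdgeD d))) :
    μ[G | edgeFiltration d ε i] =ᵐ[μ]
      μ[resampleMean p (ε i) G | edgeFiltration d ε (i + 1)] := by
  have := hμ.1
  set h := μ[G | edgeFiltration d ε i] with hh
  have hsm : StronglyMeasurable[edgeFiltration d ε i] h := stronglyMeasurable_condExp
  have hdep := dependsOn_of_measurable_edgeFiltration ε i hsm.measurable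
  have hGi : Integrable G μ := integrable_of_dependsOn hG
  have hG'i : Integrable (resampleMean p (ε i) G) μ :=
    integrable_of_dependsOn (dependsOn_resampleMean hG)
  refine ae_eq_condExp_of_forall_setIntegral_eq (edgeFiltration_le ε (i + 1)) hG'i
    (fun s _ _ => integrable_condExp.integrableOn) (fun A hA _ => ?_)
    (hsm.mono (edgeFiltration_mono ε i)).aestronglyMeasurable
  have hAm := edgeFiltration_le ε (i + 1) A hA
  rw [measurableSet_edgeFiltration_iff] at hA
  let As : Bool → Set (Config d) := fun b => {ω | setEdge ω (ε i) b ∈ A}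
  have hAs : ∀ b, MeasurableSet[edgeFiltration d ε i] (As b) := fun b => by
    rw [measurableSet_edgeFiltration_iff]
    intro ω ω' hω
    refine hA _ _ fun j hj => ?_
    by_cases hji : j = i
    · subst hji; simp
    · have : ε j ≠ ε i := fun h => hji (ε.injective h)
      rw [setEdge_of_ne _ this, setEdge_of_ne _ this, hω j (by omega)]
  have hAsm : ∀ b, MeasurableSet (As b) := fun b => edgeFiltration_le ε i _ (hAs b)
  have hA' : ∀ ω ω' : Config d, (∀ e ∈ (Finset.range (i + 1)).map ε.toEmbedding, ω e = ω' e) →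
      ω ∈ A → ω' ∈ A := fun ω ω' h' => hA ω ω' fun j hj => h' _ (by simpa using hj)
  have hAs' : ∀ b, ∀ ω ω' : Config d, (∀ e ∈ (Finset.range i).map ε.toEmbedding, ω e = ω' e) →
      ω ∈ As b → ω' ∈ As b := fun b ω ω' h' =>
    (measurableSet_edgeFiltration_iff ε i _).1 (hAs b) ω ω' fun j hj => h' _ (by simpa using hj)
  have split : ∀ (φ : Config d → ℝ) (B' : Finset (EdgeD d)), DependsOn φ (B' : Set (EdgeD d)) →
      (∀ ω b, φ (setEdge ω (ε i) b) = φ ω) →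
      ∫ ω in A, φ ω ∂μ = p * ∫ ω in As true, φ ω ∂μ + (1 - p) * ∫ ω in As false, φ ω ∂μ := by
    intro φ B' hφ hinv
    rw [← integral_indicator hAm, ← integral_indicator (hAsm _), ← integral_indicator (hAsm _),
      hμ.integral_resampleMean hp0 hp1 (ε i) (dependsOn_indicator hA' hφ),
      ← integral_const_mul, ← integral_const_mul, ← integral_add]
    · refine integral_congr_ae (Filter.Eventually.of_forall fun ω => ?_)
      have : ∀ b, A.indicator φ (setEdge ω (ε i) b) = (As b).indicator φ ω := fun b => by
        by_cases hω : setEdge ω (ε i) b ∈ A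
        · have : ω ∈ As b := hω
          simp [hω, this, hinv]
        · have : ω ∉ As b := hω
          simp [hω, this]
      simp only [resampleMean, this]
    · exact ((integrable_of_dependsOn hφ).indicator (hAsm _)).const_mul _
    · exact ((integrable_of_dependsOn hφ).indicator (hAsm _)).const_mul _
  have eq : ∀ b, ∫ ω in As b, h ω ∂μ = ∫ ω in As b, resampleMean p (ε i) G ω ∂μ := fun b => by
    rw [hh, setIntegral_condExp (edgeFiltration_le ε i) hGi (hAs b),
      ← integral_indicator (hAsm _), ← integral_indicator (hAsm _),
      hμ.integral_resampleMean hp0 hp1 (ε i) (dependsOn_indicator (hAs' b) hG)]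
    refine integral_congr_ae (Filter.Eventually.of_forall fun ω => ?_)
    have hmem : ∀ b', setEdge ω (ε i) b' ∈ As b ↔ ω ∈ As b := fun b' => by
      simp [As]
    by_cases hω : ω ∈ As b
    · simp [resampleMean, hmem, hω]
    · simp [resampleMean, hmem, hω]
  rw [split _ _ hdep, split _ _ (dependsOn_resampleMean hG), eq, eq]
  · intro ω b
    simp [resampleMean]
  · intro ω b
    refine hdep fun e he => setEdge_of_ne _ ?_ _
    rintro rfl
    simp at he

theorem IsBernoulli.integral_abs_sub_condExp_le {d : ℕ} {p : ℝ} {μ : Measure (Config d)}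
    (hμ : IsBernoulli d p μ) (hp0 : 0 ≤ p) (hp1 : p ≤ 1) (ε : ℕ ≃ EdgeD d) (i : ℕ)
    {G : Config d → ℝ} {B : Finset (EdgeD d)} (hG : DependsOn G (B : Set (EdgeD d))) :
    ∫ ω, |(μ[G | edgeFiltration d ε (i + 1)]) ω - (μ[G | edgeFiltration d ε i]) ω| ∂μ ≤
      2 * (p * (1 - p)) *
        ∫ ω, |G (setEdge ω (ε i) true) - G (setEdge ω (ε i) false)| ∂μ := by
  have := hμ.1
  have hGi : Integrable G μ := integrable_of_dependsOn hG
  have hG'i : Integrable (resampleMean p (ε i) G) μ :=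
    integrable_of_dependsOn (dependsOn_resampleMean hG)
  have h1 : (fun ω => |(μ[G | edgeFiltration d ε (i + 1)]) ω - (μ[G | edgeFiltration d ε i]) ω|)
      =ᵐ[μ] fun ω => |(μ[G - resampleMean p (ε i) G | edgeFiltration d ε (i + 1)]) ω| := by
    filter_upwards [hμ.condExp_resampleMean hp0 hp1 ε i hG,
      condExp_sub hGi hG'i (edgeFiltration d ε (i + 1))] with ω h1 h2
    rw [h2, h1]
    rfl
  rw [integral_congr_ae h1]
  refine (integral_abs_condExp_le _).trans ?_
  have hdep : DependsOn (fun ω => |(G - resampleMean p (ε i) G) ω|) (B : Set (EdgeD d)) := by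
    intro ω ω' h
    simp only [Pi.sub_apply]
    rw [hG h, dependsOn_resampleMean hG h]
  rw [hμ.integral_resampleMean hp0 hp1 (ε i) hdep, ← integral_const_mul]
  refine le_of_eq (integral_congr_ae (Filter.Eventually.of_forall fun ω => ?_))
  simp only [resampleMean, Pi.sub_apply, setEdge_setEdge]
  set a := G (setEdge ω (ε i) true)
  set b := G (setEdge ω (ε i) false)
  have e1 : a - (p * a + (1 - p) * b) = (1 - p) * (a - b) := by ring
  have e2 : b - (p * a + (1 - p) * b) = (-p) * (a - b) := by ring
  rw [e1, e2, abs_mul, abs_mul, abs_neg, abs_of_nonneg hp0, abs_of_nonneg (by linarith : 0 ≤ 1 - p)]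
  ring

/-- The absolute change of `F` when the edge `e` is switched between open and closed. -/
def influence {d : ℕ} (F : Config d → ℝ) (e : EdgeD d) (ω : Config d) : ℝ :=
  |F (setEdge ω e true) - F (setEdge ω e false)|

theorem influence_nonneg {d : ℕ} (F : Config d → ℝ) (e : EdgeD d) (ω : Config d) :
    0 ≤ influence F e ω := abs_nonneg _

theorem dependsOn_influence {d : ℕ} {F : Config d → ℝ} {B : Set (EdgeD d)}
    (hF : DependsOn F B) (e : EdgeD d) : DependsOn (influence F e) B := by
  intro ω ω' h
  have key : ∀ b, F (setEdge ω e b) = F (setEdge ω' e b) := fun b => dependsOn_setEdge hF e b h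
  simp only [influence, key]

theorem influence_setEdge {d : ℕ} (F : Config d → ℝ) (e : EdgeD d) (ω : Config d) (b : Bool) :
    influence F e (setEdge ω e b) = influence F e ω := by
  simp only [influence, setEdge_setEdge]

theorem influence_eq_zero {d : ℕ} {F : Config d → ℝ} {B : Set (EdgeD d)}
    (hF : DependsOn F B) {e : EdgeD d} (he : e ∉ B) (ω : Config d) : influence F e ω = 0 := by
  have : F (setEdge ω e true) = F (setEdge ω e false) := hF fun e' he' => by
    have : e' ≠ e := fun h => he (h ▸ he')
    rw [setEdge_of_ne _ this, setEdge_of_ne _ this]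
  simp [influence, this]

theorem abs_exp_sub_exp_le (a b : ℝ) :
    |Real.exp a - Real.exp b| ≤ |a - b| * (Real.exp a + Real.exp b) := by
  have key : ∀ x y : ℝ, Real.exp x - Real.exp y ≤ |x - y| * (Real.exp x + Real.exp y) := by
    intro x y
    have h1 := Real.add_one_le_exp (y - x)
    have h2 : Real.exp y = Real.exp x * Real.exp (y - x) := by rw [← Real.exp_add]; ring_nf
    have h3 := Real.exp_pos x
    have h4 := Real.exp_pos y
    have h5 := le_abs_self (x - y)
    have h6 : Real.exp x - Real.exp y ≤ (x - y) * Real.exp x := by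
      rw [h2]; nlinarith
    nlinarith [abs_nonneg (x - y)]
  rw [abs_le]
  constructor
  · have := key b a
    rw [abs_sub_comm] at this
    linarith
  · exact key a b

theorem dependsOn_comp {d : ℕ} {β γ : Type*} {F : Config d → β} {B : Set (EdgeD d)}
    (hF : DependsOn F B) (g : β → γ) : DependsOn (fun ω => g (F ω)) B :=
  fun _ _ h => congrArg g (hF h)

theorem dependsOn_mul {d : ℕ} {F G : Config d → ℝ} {B : Set (EdgeD d)}
    (hF : DependsOn F B) (hG : DependsOn G B) : DependsOn (fun ω => F ω * G ω) B := by
  intro ω ω' h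
  simp only [hF h, hG h]

theorem dependsOn_sum {d : ℕ} {ι : Type*} {s : Finset ι} {F : ι → Config d → ℝ}
    {B : Set (EdgeD d)} (hF : ∀ i ∈ s, DependsOn (F i) B) :
    DependsOn (fun ω => ∑ i ∈ s, F i ω) B :=
  fun _ _ h => Finset.sum_congr rfl fun i hi => hF i hi h

theorem IsBernoulli.integral_abs_exp_sub_le {d : ℕ} {p : ℝ} {μ : Measure (Config d)}
    (hμ : IsBernoulli d p μ) (hp0 : 0 ≤ p) (hp1 : p ≤ 1) (e : EdgeD d) (lam : ℝ)
    {F : Config d → ℝ} {B : Finset (EdgeD d)} (hF : DependsOn F (B : Set (EdgeD d))) :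
    p * (1 - p) * ∫ ω, |Real.exp (lam * F (setEdge ω e true)) -
        Real.exp (lam * F (setEdge ω e false))| ∂μ ≤
      |lam| * ∫ ω, influence F e ω * Real.exp (lam * F ω) ∂μ := by
  have := hμ.1
  have hG : DependsOn (fun ω => Real.exp (lam * F ω)) (B : Set (EdgeD d)) :=
    dependsOn_comp hF fun x => Real.exp (lam * x)
  have hYG : DependsOn (fun ω => influence F e ω * Real.exp (lam * F ω)) (B : Set (EdgeD d)) :=
    dependsOn_mul (dependsOn_influence hF e) hG
  rw [hμ.integral_resampleMean hp0 hp1 e hYG, ← integral_const_mul, ← integral_const_mul]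
  refine integral_mono ?_ ?_ fun ω => ?_
  · refine Integrable.const_mul (integrable_of_dependsOn (B := B) ?_) _
    intro ω ω' h
    have key : ∀ b, F (setEdge ω e b) = F (setEdge ω' e b) := fun b => dependsOn_setEdge hF e b h
    simp only [key]
  · exact (integrable_of_dependsOn (dependsOn_resampleMean hYG)).const_mul _
  · simp only [resampleMean, influence_setEdge]
    have h := abs_exp_sub_exp_le (lam * F (setEdge ω e true)) (lam * F (setEdge ω e false))
    rw [← mul_sub, abs_mul] at h
    change _ ≤ |lam| * influence F e ω * _ at h
    set y := influence F e ω with hy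
    have hy0 : 0 ≤ |lam| * y := mul_nonneg (abs_nonneg _) (influence_nonneg F e ω)
    set a := Real.exp (lam * F (setEdge ω e true)) with ha
    set b := Real.exp (lam * F (setEdge ω e false)) with hb
    have ha0 : 0 < a := Real.exp_pos _
    have hb0 : 0 < b := Real.exp_pos _
    have hq : 0 ≤ 1 - p := by linarith
    have h1 : p * (1 - p) * (a + b) ≤ p * a + (1 - p) * b := by
      nlinarith [mul_nonneg (mul_nonneg hp0 hp0) ha0.le, mul_nonneg (mul_nonneg hq hq) hb0.le]
    calc p * (1 - p) * |a - b| ≤ p * (1 - p) * (|lam| * y * (a + b)) :=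
          mul_le_mul_of_nonneg_left h (mul_nonneg hp0 hq)
      _ = |lam| * y * (p * (1 - p) * (a + b)) := by ring
      _ ≤ |lam| * y * (p * a + (1 - p) * b) := mul_le_mul_of_nonneg_left h1 hy0
      _ = _ := by ring

theorem sum_integral_mul_sq_le {d : ℕ} {μ : Measure (Config d)} [IsProbabilityMeasure μ]
    {B : Finset (EdgeD d)} {Y : EdgeD d → Config d → ℝ} {G : Config d → ℝ} {H : ℝ} (hH : 0 < H)
    (hY0 : ∀ e ω, 0 ≤ Y e ω) (hY : ∀ e, DependsOn (Y e) (B : Set (EdgeD d)))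
    (hG : DependsOn G (B : Set (EdgeD d)))
    (hYH : ∀ e ∈ B, ∫ ω, Y e ω * ∑ e' ∈ B, Y e' ω ∂μ ≤ H) :
    ∑ e ∈ B, (∫ ω, Y e ω * G ω ∂μ) ^ 2 ≤ H * ∫ ω, G ω ^ 2 ∂μ := by
  set Q : EdgeD d → ℝ := fun e => ∫ ω, Y e ω * G ω ∂μ with hQ
  have hsumY : DependsOn (fun ω => ∑ e' ∈ B, Y e' ω) (B : Set (EdgeD d)) :=
    dependsOn_sum fun e _ => hY e
  have h1 : ∑ e ∈ B, Q e ^ 2 = ∫ ω, (∑ e ∈ B, Q e * Y e ω) * G ω ∂μ := by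
    simp only [Finset.sum_mul]
    rw [integral_finsetSum]
    · refine Finset.sum_congr rfl fun e _ => ?_
      simp only [mul_assoc]
      rw [integral_const_mul, sq]
    · intro e _
      simp only [mul_assoc]
      exact (integrable_of_dependsOn (dependsOn_mul (hY e) hG)).const_mul _
  have h2 : ∀ ω, (∑ e ∈ B, Q e * Y e ω) * G ω ≤
      H / 2 * G ω ^ 2 + (2 * H)⁻¹ * ∑ e ∈ B, Q e ^ 2 * (Y e ω * ∑ e' ∈ B, Y e' ω) := by
    intro ω
    set X := ∑ e ∈ B, Q e * Y e ω with hX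
    have h3 : X ^ 2 ≤ ∑ e ∈ B, Q e ^ 2 * (Y e ω * ∑ e' ∈ B, Y e' ω) := by
      have := Finset.sum_sq_le_sum_mul_sum_of_sq_le_mul B (r := fun e => Q e * Y e ω)
        (f := fun e => Q e ^ 2 * Y e ω) (g := fun e => Y e ω)
        (fun e _ => mul_nonneg (sq_nonneg _) (hY0 e ω)) (fun e _ => hY0 e ω)
        (fun e _ => le_of_eq (by ring))
      refine this.trans (le_of_eq ?_)
      rw [Finset.sum_mul]
      exact Finset.sum_congr rfl fun e _ => by ring
    have h4 : X * G ω ≤ H / 2 * G ω ^ 2 + (2 * H)⁻¹ * X ^ 2 := by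
      have : H / 2 * G ω ^ 2 + (2 * H)⁻¹ * X ^ 2 - X * G ω = (2 * H)⁻¹ * (H * G ω - X) ^ 2 := by
        field_simp
        ring
      have : 0 ≤ (2 * H)⁻¹ * (H * G ω - X) ^ 2 := by positivity
      linarith
    have : (2 * H)⁻¹ * X ^ 2 ≤ (2 * H)⁻¹ * ∑ e ∈ B, Q e ^ 2 * (Y e ω * ∑ e' ∈ B, Y e' ω) :=
      mul_le_mul_of_nonneg_left h3 (by positivity)
    linarith
  have hi1 : Integrable (fun ω => H / 2 * G ω ^ 2) μ :=
    (integrable_of_dependsOn (dependsOn_comp hG fun x => x ^ 2)).const_mul _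
  have hi2 : ∀ e ∈ B, Integrable (fun ω => Q e ^ 2 * (Y e ω * ∑ e' ∈ B, Y e' ω)) μ := fun e _ =>
    (integrable_of_dependsOn (dependsOn_mul (hY e) hsumY)).const_mul _
  have h5 : ∑ e ∈ B, Q e ^ 2 ≤ H / 2 * ∫ ω, G ω ^ 2 ∂μ + (2 * H)⁻¹ * ∑ e ∈ B, Q e ^ 2 * H := by
    calc ∑ e ∈ B, Q e ^ 2 = ∫ ω, (∑ e ∈ B, Q e * Y e ω) * G ω ∂μ := h1
      _ ≤ ∫ ω, (H / 2 * G ω ^ 2 +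
            (2 * H)⁻¹ * ∑ e ∈ B, Q e ^ 2 * (Y e ω * ∑ e' ∈ B, Y e' ω)) ∂μ := by
          refine integral_mono ?_ (hi1.add ((integrable_finsetSum _ hi2).const_mul _)) h2
          exact integrable_of_dependsOn (dependsOn_mul
            (dependsOn_sum fun e _ => dependsOn_comp (hY e) fun x => Q e * x) hG)
      _ = H / 2 * ∫ ω, G ω ^ 2 ∂μ +
            (2 * H)⁻¹ * ∑ e ∈ B, Q e ^ 2 * ∫ ω, Y e ω * ∑ e' ∈ B, Y e' ω ∂μ := by
          rw [integral_add hi1 ((integrable_finsetSum _ hi2).const_mul _), integral_const_mul,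
            integral_const_mul, integral_finsetSum _ hi2]
          simp only [integral_const_mul]
      _ ≤ _ := by
          gcongr with e he
          exact hYH e he
  rw [← Finset.sum_mul] at h5
  have h6 : (2 * H)⁻¹ * ((∑ e ∈ B, Q e ^ 2) * H) = (∑ e ∈ B, Q e ^ 2) / 2 := by
    field_simp
  rw [h6] at h5
  linarith

/-- If `F` depends on finitely many edges, the sum of the squared `L¹` norms of the martingale
increments of `exp (lam * F)` is controlled by the row sums of the influence matrix. -/
theorem IsBernoulli.tsum_lintegral_increment_sq_le {d : ℕ} {p : ℝ} {μ : Measure (Config d)}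
    (hμ : IsBernoulli d p μ) (hp0 : 0 ≤ p) (hp1 : p ≤ 1) (ε : ℕ ≃ EdgeD d) (lam : ℝ)
    {F : Config d → ℝ} {B : Finset (EdgeD d)} (hF : DependsOn F (B : Set (EdgeD d)))
    {H : ℝ} (hH : 0 < H)
    (hYH : ∀ e ∈ B, ∫ ω, influence F e ω * ∑ e' ∈ B, influence F e' ω ∂μ ≤ H) :
    ∑' i : ℕ, (∫⁻ ω, ENNReal.ofReal
        |(μ[fun ω' => Real.exp (lam * F ω') | edgeFiltration d ε (i + 1)]) ω -
          (μ[fun ω' => Real.exp (lam * F ω') | edgeFiltration d ε i]) ω| ∂μ) ^ 2 ≤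
      ENNReal.ofReal (4 * lam ^ 2 * H) * ∫⁻ ω, ENNReal.ofReal (Real.exp (2 * lam * F ω)) ∂μ := by
  have := hμ.1
  have hG : DependsOn (fun ω => Real.exp (lam * F ω)) (B : Set (EdgeD d)) :=
    dependsOn_comp hF fun x => Real.exp (lam * x)
  set Q : EdgeD d → ℝ := fun e => ∫ ω, influence F e ω * Real.exp (lam * F ω) ∂μ with hQ
  have hQ0 : ∀ e, 0 ≤ Q e := fun e =>
    integral_nonneg fun ω => mul_nonneg (influence_nonneg F e ω) (Real.exp_pos _).le
  have hterm : ∀ i, (∫⁻ ω, ENNReal.ofReal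
        |(μ[fun ω' => Real.exp (lam * F ω') | edgeFiltration d ε (i + 1)]) ω -
          (μ[fun ω' => Real.exp (lam * F ω') | edgeFiltration d ε i]) ω| ∂μ) ^ 2 ≤
      ENNReal.ofReal (4 * lam ^ 2 * Q (ε i) ^ 2) := by
    intro i
    have h1 := hμ.integral_abs_sub_condExp_le hp0 hp1 ε i hG
    have h2 := hμ.integral_abs_exp_sub_le hp0 hp1 (ε i) lam hF
    have hint : Integrable (fun ω =>
        |(μ[fun ω' => Real.exp (lam * F ω') | edgeFiltration d ε (i + 1)]) ω -
          (μ[fun ω' => Real.exp (lam * F ω') | edgeFiltration d ε i]) ω|) μ :=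
      (integrable_condExp.sub integrable_condExp).abs
    rw [← ofReal_integral_eq_lintegral_ofReal hint
      (Filter.Eventually.of_forall fun ω => abs_nonneg _), ← ENNReal.ofReal_pow
      (integral_nonneg fun ω => abs_nonneg _)]
    refine ENNReal.ofReal_le_ofReal ?_
    have h3 : ∀ x : ℝ, 0 ≤ x → x ≤ 2 * (|lam| * Q (ε i)) → x ^ 2 ≤ 4 * lam ^ 2 * Q (ε i) ^ 2 := by
      intro x hx0 hx
      calc x ^ 2 ≤ (2 * (|lam| * Q (ε i))) ^ 2 := pow_le_pow_left₀ hx0 hx 2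
        _ = 4 * |lam| ^ 2 * Q (ε i) ^ 2 := by ring
        _ = _ := by rw [sq_abs]
    refine h3 _ (integral_nonneg fun ω => abs_nonneg _) (h1.trans ?_)
    rw [mul_assoc]
    exact mul_le_mul_of_nonneg_left h2 (by norm_num)
  refine (ENNReal.tsum_le_tsum hterm).trans ?_
  rw [ε.tsum_eq (fun e => ENNReal.ofReal (4 * lam ^ 2 * Q e ^ 2)), tsum_eq_sum (s := B),
    ← ENNReal.ofReal_sum_of_nonneg fun e _ => by positivity]
  · rw [← ofReal_integral_eq_lintegral_ofReal
      (integrable_of_dependsOn (dependsOn_comp hF fun x => Real.exp (2 * lam * x)))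
      (Filter.Eventually.of_forall fun ω => (Real.exp_pos _).le),
      ← ENNReal.ofReal_mul (by positivity)]
    refine ENNReal.ofReal_le_ofReal ?_
    have h := sum_integral_mul_sq_le hH (influence_nonneg F) (dependsOn_influence hF) hG hYH
    have h' : ∀ ω, Real.exp (2 * lam * F ω) = Real.exp (lam * F ω) ^ 2 := fun ω => by
      rw [← Real.exp_nat_mul]; congr 1; push_cast; ring
    simp only [h', ← Finset.mul_sum]
    rw [mul_assoc (4 * lam ^ 2)]
    exact mul_le_mul_of_nonneg_left h (by positivity)
  · intro e he
    have : Q e = 0 := by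
      simp [hQ, influence_eq_zero hF (fun h => he (by simpa using h))]
    simp [this]

theorem norm1_cast_zmod {d : ℕ} (x : ZVec d) : (norm1 d x : ZMod 2) = ∑ i, ((x i : ℤ) : ZMod 2) := by
  rw [norm1, Nat.cast_sum]
  refine Finset.sum_congr rfl fun i _ => ?_
  rcases Int.natAbs_eq (x i) with h | h
  · conv_rhs => rw [h]
    simp
  · conv_rhs => rw [h]
    simp [ZMod.neg_eq_self_mod_two]

theorem norm1_sub_comm {d : ℕ} (x y : ZVec d) : norm1 d (x - y) = norm1 d (y - x) := by
  refine Finset.sum_congr rfl fun i _ => ?_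
  simp only [Pi.sub_apply]
  omega

theorem norm1_triangle {d : ℕ} (x y z : ZVec d) :
    norm1 d (x - z) ≤ norm1 d (x - y) + norm1 d (y - z) := by
  rw [norm1, norm1, norm1, ← Finset.sum_add_distrib]
  refine Finset.sum_le_sum fun i _ => ?_
  simp only [Pi.sub_apply]
  omega

theorem Adj.symm {d : ℕ} {x y : ZVec d} (h : Adj d x y) : Adj d y x :=
  (norm1_sub_comm y x).trans h

theorem Adj.norm1_ne {d : ℕ} {x y : ZVec d} (h : Adj d x y) : norm1 d x ≠ norm1 d y := by
  intro hxy
  have h1 := norm1_cast_zmod (x - y)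
  have h2 := norm1_cast_zmod x
  have h3 := norm1_cast_zmod y
  rw [show norm1 d (x - y) = 1 from h] at h1
  simp only [Pi.sub_apply, Int.cast_sub, Finset.sum_sub_distrib, ← h2, ← h3, hxy, sub_self] at h1
  simp at h1

/-- The edge `e` joins the vertices `x` and `y`. -/
def Joins {d : ℕ} (e : EdgeD d) (x y : ZVec d) : Prop := e.val = (x, y) ∨ e.val = (y, x)

theorem Joins.symm {d : ℕ} {e : EdgeD d} {x y : ZVec d} (h : Joins e x y) : Joins e y x := Or.symm h

theorem joins_comm {d : ℕ} {e : EdgeD d} {x y : ZVec d} : Joins e x y ↔ Joins e y x := or_comm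

theorem joins_endpoints {d : ℕ} (e : EdgeD d) : Joins e e.val.1 e.val.2 := Or.inl rfl

theorem Joins.adj {d : ℕ} {e : EdgeD d} {x y : ZVec d} (h : Joins e x y) : Adj d x y := by
  have h1 : Adj d e.val.1 e.val.2 := e.2.1
  rcases h with h | h
  · simpa [h] using h1
  · simpa [h] using h1.symm

theorem Joins.eq {d : ℕ} {e e' : EdgeD d} {x y : ZVec d} (h : Joins e x y) (h' : Joins e' x y) :
    e = e' := by
  have h1 := e.2.2
  have h2 := e'.2.2
  refine Subtype.ext ?_
  rcases h with h | h <;> rcases h' with h' | h' <;> simp only [h, h'] at h1 h2 ⊢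
  · exact absurd h2 h1.asymm
  · exact absurd h2 h1.asymm

theorem Adj.exists_joins {d : ℕ} {x y : ZVec d} (h : Adj d x y) : ∃ e : EdgeD d, Joins e x y := by
  rcases lt_or_gt_of_ne h.norm1_ne with h' | h'
  · exact ⟨⟨(x, y), h, h'⟩, Or.inl rfl⟩
  · exact ⟨⟨(y, x), h.symm, h'⟩, Or.inr rfl⟩

/-- The edge joining `x` and `y` as a finite set, empty if they are not adjacent. -/
def linkEdges {d : ℕ} (x y : ZVec d) : Finset (EdgeD d) :=
  if h : ∃ e : EdgeD d, Joins e x y then {h.choose} else ∅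

theorem mem_linkEdges {d : ℕ} {e : EdgeD d} {x y : ZVec d} : e ∈ linkEdges x y ↔ Joins e x y := by
  unfold linkEdges
  split_ifs with h
  · rw [Finset.mem_singleton]
    exact ⟨fun h' => h' ▸ h.choose_spec, fun h' => h'.eq h.choose_spec⟩
  · simp only [Finset.notMem_empty, false_iff]
    exact fun h' => h ⟨e, h'⟩

theorem linkEdges_comm {d : ℕ} (x y : ZVec d) : linkEdges x y = linkEdges y x := by
  ext e; rw [mem_linkEdges, mem_linkEdges, joins_comm]

theorem card_linkEdges_le {d : ℕ} (x y : ZVec d) : (linkEdges x y).card ≤ 1 :=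
  Finset.card_le_one.2 fun _ h _ h' => (mem_linkEdges.1 h).eq (mem_linkEdges.1 h')

/-- The set of edges of a lattice path. -/
def pathEdges {d : ℕ} : List (ZVec d) → Finset (EdgeD d)
  | [] => ∅
  | [_] => ∅
  | x :: y :: rest => linkEdges x y ∪ pathEdges (y :: rest)

theorem card_pathEdges_le {d : ℕ} : ∀ γ : List (ZVec d), (pathEdges γ).card ≤ γ.length - 1
  | [] => by simp [pathEdges]
  | [_] => by simp [pathEdges]
  | x :: y :: r => by
    have h1 := card_pathEdges_le (y :: r)
    have h2 := card_linkEdges_le x y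
    have h3 := Finset.card_union_le (linkEdges x y) (pathEdges (y :: r))
    simp only [pathEdges, List.length_cons] at *
    omega

theorem mem_of_mem_pathEdges {d : ℕ} {e : EdgeD d} : ∀ {γ : List (ZVec d)},
    e ∈ pathEdges γ → e.val.1 ∈ γ ∧ e.val.2 ∈ γ
  | [] => by simp [pathEdges]
  | [_] => by simp [pathEdges]
  | x :: y :: r => by
    intro h
    rw [pathEdges, Finset.mem_union, mem_linkEdges] at h
    rcases h with (h | h) | h
    · simp [h]
    · simp [h]
    · have := mem_of_mem_pathEdges h
      exact ⟨List.mem_cons_of_mem _ this.1, List.mem_cons_of_mem _ this.2⟩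

theorem pathEdges_append {d : ℕ} : ∀ (a : List (ZVec d)) (x : ZVec d) (b : List (ZVec d)),
    pathEdges (a ++ x :: b) = pathEdges (a ++ [x]) ∪ pathEdges (x :: b)
  | [], x, b => by simp [pathEdges]
  | [u], x, b => by simp [pathEdges]
  | u :: v :: a, x, b => by
    have := pathEdges_append (v :: a) x b
    simp only [List.cons_append, pathEdges] at this ⊢
    rw [this, Finset.union_assoc]

theorem pathCost_append {d n : ℕ} {ω : Config d} : ∀ (a : List (ZVec d)) (x : ZVec d)
    (b : List (ZVec d)),
    pathCost d n ω (a ++ x :: b) = pathCost d n ω (a ++ [x]) + pathCost d n ω (x :: b)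
  | [], x, b => by simp [pathCost]
  | [u], x, b => by simp [pathCost]
  | u :: v :: a, x, b => by
    have := pathCost_append (n := n) (ω := ω) (v :: a) x b
    simp only [List.cons_append, pathCost] at this ⊢
    rw [this, add_assoc]

theorem edgeOpen_iff {d : ℕ} {ω : Config d} {x y : ZVec d} :
    EdgeOpen d ω x y ↔ ∃ e ∈ linkEdges x y, ω e = true := by
  simp only [mem_linkEdges, EdgeOpen, Joins]

theorem edgeOpen_comm {d : ℕ} {ω : Config d} {x y : ZVec d} :
    EdgeOpen d ω x y ↔ EdgeOpen d ω y x := by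
  rw [edgeOpen_iff, edgeOpen_iff, linkEdges_comm]

theorem pairWeight_comm {d n : ℕ} {ω : Config d} (x y : ZVec d) :
    pairWeight d n ω x y = pairWeight d n ω y x := by
  simp only [pairWeight, edgeOpen_comm (x := x)]

theorem pathEdges_reverse {d : ℕ} : ∀ γ : List (ZVec d), pathEdges γ.reverse = pathEdges γ
  | [] => by simp [pathEdges]
  | [_] => by simp [pathEdges]
  | x :: y :: r => by
    have := pathEdges_reverse (y :: r)
    rw [List.reverse_cons] at this
    rw [List.reverse_cons, List.reverse_cons, List.append_assoc, List.singleton_append,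
      pathEdges_append, this]
    simp only [pathEdges, Finset.union_empty]
    rw [Finset.union_comm, linkEdges_comm]

theorem pathCost_reverse {d n : ℕ} {ω : Config d} : ∀ γ : List (ZVec d),
    pathCost d n ω γ.reverse = pathCost d n ω γ
  | [] => by simp
  | [_] => by simp
  | x :: y :: r => by
    have := pathCost_reverse (n := n) (ω := ω) (y :: r)
    rw [List.reverse_cons] at this
    rw [List.reverse_cons, List.reverse_cons, List.append_assoc, List.singleton_append,
      pathCost_append, this]
    simp only [pathCost, add_zero]
    rw [add_comm, pairWeight_comm]

theorem pairWeight_nonneg {d n : ℕ} {ω : Config d} (x y : ZVec d) : 0 ≤ pairWeight d n ω x y := by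
  unfold pairWeight; split_ifs <;> positivity

theorem pathCost_nonneg {d n : ℕ} {ω : Config d} : ∀ γ : List (ZVec d), 0 ≤ pathCost d n ω γ
  | [] => le_rfl
  | [_] => le_rfl
  | x :: y :: r => add_nonneg (pairWeight_nonneg x y) (pathCost_nonneg (y :: r))

theorem pathCost_mono_of_open {d n : ℕ} (hn : 1 ≤ Real.log n ^ 2) {ω ω' : Config d} :
    ∀ {γ : List (ZVec d)}, (∀ e ∈ pathEdges γ, ω e = true → ω' e = true) →
      pathCost d n ω' γ ≤ pathCost d n ω γ
  | [], _ => le_rfl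
  | [_], _ => le_rfl
  | x :: y :: r, h => by
    have h1 := pathCost_mono_of_open hn (γ := y :: r) fun e he =>
      h e (Finset.mem_union_right _ he)
    have h2 : EdgeOpen d ω x y → EdgeOpen d ω' x y := by
      rw [edgeOpen_iff, edgeOpen_iff]
      rintro ⟨e, he, ho⟩
      exact ⟨e, he, h e (Finset.mem_union_left _ he) ho⟩
    have h3 : pairWeight d n ω' x y ≤ pairWeight d n ω x y := by
      unfold pairWeight
      split_ifs <;> first | exact le_rfl | assumption | tauto
    exact add_le_add h3 h1

theorem pathCost_congr {d n : ℕ} {ω ω' : Config d} :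
    ∀ {γ : List (ZVec d)}, (∀ e ∈ pathEdges γ, ω e = ω' e) →
      pathCost d n ω γ = pathCost d n ω' γ
  | [], _ => rfl
  | [_], _ => rfl
  | x :: y :: r, h => by
    have h1 := pathCost_congr (n := n) (γ := y :: r) fun e he => h e (Finset.mem_union_right _ he)
    have h2 : EdgeOpen d ω x y ↔ EdgeOpen d ω' x y := by
      rw [edgeOpen_iff, edgeOpen_iff]
      exact exists_congr fun e => and_congr_right fun he => by
        rw [h e (Finset.mem_union_left _ he)]
    simp only [pathCost, h1, pairWeight, h2]

theorem mul_length_le_pathCost {d n : ℕ} {ω : Config d} {c : ℝ} (hc1 : c ≤ 1)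
    (hc : c ≤ Real.log n ^ 2) : ∀ γ : List (ZVec d),
      c * ((γ.length - 1 : ℕ) : ℝ) ≤ pathCost d n ω γ
  | [] => by simp [pathCost]
  | [_] => by simp [pathCost]
  | x :: y :: r => by
    have h1 := mul_length_le_pathCost (ω := ω) hc1 hc (y :: r)
    have h2 : c ≤ pairWeight d n ω x y := by unfold pairWeight; split_ifs <;> assumption
    simp only [List.length_cons, Nat.add_sub_cancel, pathCost] at h1 ⊢
    push_cast
    linarith

theorem pathCost_le_mul_length {d n : ℕ} {ω : Config d} {c : ℝ} (hc1 : 1 ≤ c)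
    (hc : Real.log n ^ 2 ≤ c) : ∀ γ : List (ZVec d),
      pathCost d n ω γ ≤ c * ((γ.length - 1 : ℕ) : ℝ)
  | [] => by simp [pathCost]
  | [_] => by simp [pathCost]
  | x :: y :: r => by
    have h1 := pathCost_le_mul_length (ω := ω) hc1 hc (y :: r)
    have h2 : pairWeight d n ω x y ≤ c := by unfold pairWeight; split_ifs <;> assumption
    simp only [List.length_cons, Nat.add_sub_cancel, pathCost] at h1 ⊢
    push_cast
    linarith

theorem exists_pathCost_eq {d n : ℕ} {ω : Config d} : ∀ γ : List (ZVec d),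
    ∃ a b : ℕ, pathCost d n ω γ = a + b * Real.log n ^ 2
  | [] => ⟨0, 0, by simp [pathCost]⟩
  | [_] => ⟨0, 0, by simp [pathCost]⟩
  | x :: y :: r => by
    obtain ⟨a, b, h⟩ := exists_pathCost_eq (n := n) (ω := ω) (y :: r)
    by_cases ho : EdgeOpen d ω x y
    · refine ⟨a + 1, b, ?_⟩
      simp only [pathCost, h, pairWeight, ho, if_true]
      push_cast; ring
    · refine ⟨a, b + 1, ?_⟩
      simp only [pathCost, h, pairWeight, ho, if_false]
      push_cast; ring

theorem pathCost_setEdge_le {d n : ℕ} {ω : Config d} {e : EdgeD d} :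
    ∀ {γ : List (ZVec d)}, γ.Nodup →
      pathCost d n (setEdge ω e false) γ ≤ pathCost d n (setEdge ω e true) γ + Real.log n ^ 2
  | [], _ => by simp [pathCost]; positivity
  | [_], _ => by simp [pathCost]; positivity
  | x :: y :: r, h => by
    have h' := List.nodup_cons.1 h
    by_cases he : Joins e x y
    · have h1 : pathCost d n (setEdge ω e false) (y :: r) =
          pathCost d n (setEdge ω e true) (y :: r) := by
        refine pathCost_congr fun e' he' => ?_
        have : e' ≠ e := by
          rintro rfl
          have := mem_of_mem_pathEdges he'
          rcases he with he | he <;> simp [he] at this h'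
          · exact h'.1.1 (by tauto)
          · tauto
        rw [setEdge_of_ne _ this, setEdge_of_ne _ this]
      have h2 : ¬ EdgeOpen d (setEdge ω e false) x y := by
        rw [edgeOpen_iff]
        rintro ⟨e', he', ho⟩
        rw [(mem_linkEdges.1 he').eq he] at ho
        simp at ho
      have h3 := pairWeight_nonneg (n := n) (ω := setEdge ω e true) x y
      simp only [pathCost, h1]
      simp only [pairWeight, h2, if_false] at h3 ⊢
      linarith
    · have h1 : pathCost d n (setEdge ω e false) [x, y] =
          pathCost d n (setEdge ω e true) [x, y] := by
        refine pathCost_congr fun e' he' => ?_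
        have : e' ≠ e := by
          rintro rfl
          simp only [pathEdges, Finset.union_empty, mem_linkEdges] at he'
          exact he he'
        rw [setEdge_of_ne _ this, setEdge_of_ne _ this]
      have h2 := pathCost_setEdge_le (n := n) (ω := ω) (e := e) h'.2
      simp only [pathCost, add_zero] at h1 ⊢
      linarith

/-- `γ` is a nearest-neighbour walk from `x` to `y`. -/
def IsWalk {d : ℕ} (x y : ZVec d) (γ : List (ZVec d)) : Prop :=
  γ.IsChain (Adj d) ∧ γ.head? = some x ∧ γ.getLast? = some y

theorem IsWalk.reverse {d : ℕ} {x y : ZVec d} {γ : List (ZVec d)} (h : IsWalk x y γ) :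
    IsWalk y x γ.reverse := by
  refine ⟨List.isChain_reverse.2 (h.1.imp fun a b hab => hab.symm), ?_, ?_⟩
  · rw [List.head?_reverse, h.2.2]
  · rw [List.getLast?_reverse, h.2.1]

theorem IsWalk.cons {d : ℕ} {x y z : ZVec d} {γ : List (ZVec d)} (hxy : Adj d x y)
    (h : IsWalk y z γ) : IsWalk x z (x :: γ) := by
  obtain ⟨h1, h2, h3⟩ := h
  cases γ with
  | nil => simp at h2
  | cons u r =>
    obtain rfl : u = y := by simpa using h2
    exact ⟨List.isChain_cons_cons.2 ⟨hxy, h1⟩, by simp, by simpa using h3⟩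

theorem exists_isPath_le {d n : ℕ} {ω : Config d} : ∀ {γ : List (ZVec d)} {x y : ZVec d},
    IsWalk x y γ → ∃ γ', IsPath d γ' ∧ γ'.head? = some x ∧ γ'.getLast? = some y ∧
      pathCost d n ω γ' ≤ pathCost d n ω γ
  | [], x, y, h => by simp [IsWalk] at h
  | [u], x, y, h => by
    refine ⟨[u], ⟨by simp, by simp, by exact List.isChain_singleton _⟩, h.2.1, h.2.2, le_rfl⟩
  | u :: v :: r, x, y, h => by
    obtain rfl : u = x := by simpa using h.2.1
    have hc := List.isChain_cons_cons.1 h.1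
    obtain ⟨γ', hp, hh, hl, hle⟩ := exists_isPath_le (n := n) (ω := ω) (γ := v :: r) (x := v)
      (y := y) ⟨hc.2, rfl, by simpa using h.2.2⟩
    by_cases hu : u ∈ γ'
    · obtain ⟨s, t, rfl⟩ := List.append_of_mem hu
      refine ⟨u :: t, ⟨by simp, hp.2.1.of_append_right, ?_⟩, rfl, ?_, ?_⟩
      · exact (List.isChain_append.1 hp.2.2).2.1
      · simpa using hl
      · rw [pathCost_append] at hle
        have := pathCost_nonneg (n := n) (ω := ω) (s ++ [u])
        have := pairWeight_nonneg (n := n) (ω := ω) u v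
        simp only [pathCost] at hle ⊢
        linarith
    · have hw := IsWalk.cons hc.1 ⟨hp.2.2, hh, hl⟩
      refine ⟨u :: γ', ⟨by simp, List.nodup_cons.2 ⟨hu, hp.2.1⟩, hw.1⟩, rfl, hw.2.2, ?_⟩
      cases γ' with
      | nil => simp at hh
      | cons w t =>
        obtain rfl : w = v := by simpa using hh
        simp only [pathCost]
        linarith

theorem exists_isWalk {d : ℕ} : ∀ (k : ℕ) (x y : ZVec d), norm1 d (x - y) = k →
    ∃ γ, IsWalk x y γ ∧ γ.length = k + 1
  | 0, x, y, h => by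
    have : x = y := by
      funext i
      have := (Finset.sum_eq_zero_iff.1 h) i (Finset.mem_univ i)
      simp only [Pi.sub_apply] at this
      omega
    subst this
    exact ⟨[x], ⟨by simp, rfl, rfl⟩, rfl⟩
  | k + 1, x, y, h => by
    obtain ⟨i, -, hi⟩ := Finset.exists_ne_zero_of_sum_ne_zero
      (show ∑ i, ((x - y) i).natAbs ≠ 0 by
        change norm1 d (x - y) ≠ 0
        omega)
    simp only [Pi.sub_apply] at hi
    let s : ℤ := if x i < y i then 1 else -1
    have hs : (x i - y i).natAbs = 1 + (x i + s - y i).natAbs ∧ s.natAbs = 1 := by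
      simp only [s]; split_ifs <;> omega
    let x' : ZVec d := Function.update x i (x i + s)
    have hx' : norm1 d (x' - y) = k := by
      unfold norm1 at h ⊢
      rw [← Finset.add_sum_erase _ _ (Finset.mem_univ i)] at h ⊢
      have : ∑ j ∈ Finset.univ.erase i, ((x' - y) j).natAbs =
          ∑ j ∈ Finset.univ.erase i, ((x - y) j).natAbs := by
        refine Finset.sum_congr rfl fun j hj => ?_
        simp [x', Function.update_of_ne (Finset.ne_of_mem_erase hj)]
      rw [this]
      simp only [Pi.sub_apply, x', Function.update_self] at h ⊢
      omega
    have hadj : Adj d x x' := by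
      unfold Adj norm1
      rw [← Finset.add_sum_erase _ _ (Finset.mem_univ i), Finset.sum_eq_zero]
      · simp [x', hs.2]
      · intro j hj
        simp [x', Function.update_of_ne (Finset.ne_of_mem_erase hj)]
    obtain ⟨γ, hγ, hl⟩ := exists_isWalk k x' y hx'
    exact ⟨x :: γ, hγ.cons hadj, by simp [hl]⟩

theorem bddBelow_pathCosts {d n : ℕ} {ω : Config d} {x y : ZVec d} :
    BddBelow {c : ℝ | ∃ γ : List (ZVec d), IsPath d γ ∧ γ.head? = some x ∧
      γ.getLast? = some y ∧ pathCost d n ω γ = c} :=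
  ⟨0, by rintro c ⟨γ, -, -, -, rfl⟩; exact pathCost_nonneg γ⟩

theorem passageTime_le {d n : ℕ} {ω : Config d} {x y : ZVec d} {γ : List (ZVec d)}
    (h : IsWalk x y γ) : passageTime d n ω x y ≤ pathCost d n ω γ := by
  obtain ⟨γ', hp, hh, hl, hle⟩ := exists_isPath_le (n := n) (ω := ω) h
  exact (csInf_le bddBelow_pathCosts ⟨γ', hp, hh, hl, rfl⟩).trans hle

theorem passageTime_le_norm1 {d n : ℕ} {ω : Config d} {c : ℝ} (hc1 : 1 ≤ c)
    (hc : Real.log n ^ 2 ≤ c) (x y : ZVec d) :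
    passageTime d n ω x y ≤ c * norm1 d (x - y) := by
  obtain ⟨γ, hγ, hl⟩ := exists_isWalk _ x y rfl
  refine (passageTime_le hγ).trans ((pathCost_le_mul_length hc1 hc γ).trans ?_)
  rw [hl, Nat.add_sub_cancel]

theorem exists_geodesic {d n : ℕ} (hn : 0 < Real.log n) (ω : Config d) (x y : ZVec d) :
    ∃ γ, IsPath d γ ∧ γ.head? = some x ∧ γ.getLast? = some y ∧
      pathCost d n ω γ = passageTime d n ω x y := by
  obtain ⟨γ, hγ, -⟩ := exists_isWalk _ x y rfl
  obtain ⟨γ', hp, hh, hl, -⟩ := exists_isPath_le (n := n) (ω := ω) hγ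
  set S := {c : ℝ | ∃ γ : List (ZVec d), IsPath d γ ∧ γ.head? = some x ∧
      γ.getLast? = some y ∧ pathCost d n ω γ = c} with hS
  set c₀ := pathCost d n ω γ'
  have hL : 0 < Real.log n ^ 2 := by positivity
  have hfin : (S ∩ Set.Iic c₀).Finite := by
    refine ((((Finset.range (⌊c₀⌋₊ + 1)) ×ˢ
      (Finset.range (⌊c₀ / Real.log n ^ 2⌋₊ + 1))).image
        fun ab : ℕ × ℕ => (ab.1 : ℝ) + ab.2 * Real.log n ^ 2).finite_toSet).subset ?_
    rintro c ⟨⟨δ, -, -, -, rfl⟩, hc⟩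
    obtain ⟨a, b, hab⟩ := exists_pathCost_eq (n := n) (ω := ω) δ
    rw [Set.mem_Iic, hab] at hc
    have h1 : (a : ℝ) ≤ c₀ := by nlinarith [Nat.cast_nonneg (α := ℝ) b]
    have h2 : (b : ℝ) ≤ c₀ / Real.log n ^ 2 := by
      rw [le_div_iff₀ hL]; linarith [Nat.cast_nonneg (α := ℝ) a]
    simp only [Finset.coe_image, Finset.coe_product, Set.mem_image, Prod.exists]
    refine ⟨a, b, ?_, hab.symm⟩
    simp only [Set.mem_prod, Finset.coe_range, Set.mem_Iio]
    exact ⟨Nat.lt_succ_of_le (Nat.le_floor h1), Nat.lt_succ_of_le (Nat.le_floor h2)⟩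
  obtain ⟨m, hm, hmin⟩ := Set.exists_min_image _ id hfin
    ⟨c₀, ⟨γ', hp, hh, hl, rfl⟩, Set.mem_Iic.2 le_rfl⟩
  obtain ⟨⟨δ, h1, h2, h3, h4⟩, hm2⟩ := hm
  refine ⟨δ, h1, h2, h3, ?_⟩
  rw [h4]
  have hleast : IsLeast S m := by
    refine ⟨⟨δ, h1, h2, h3, h4⟩, fun c hc => ?_⟩
    by_cases hcc : c ≤ c₀
    · exact hmin c ⟨hc, hcc⟩
    · exact (Set.mem_Iic.1 hm2).trans (not_le.1 hcc).le
  exact hleast.csInf_eq.symm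

/-- A chosen geodesic between `x` and `y`. -/
def geoPath (d n : ℕ) (ω : Config d) (x y : ZVec d) : List (ZVec d) :=
  if h : 0 < Real.log n then (exists_geodesic h ω x y).choose else []

theorem geoPath_spec {d n : ℕ} (hn : 0 < Real.log n) (ω : Config d) (x y : ZVec d) :
    IsPath d (geoPath d n ω x y) ∧ (geoPath d n ω x y).head? = some x ∧
      (geoPath d n ω x y).getLast? = some y ∧
      pathCost d n ω (geoPath d n ω x y) = passageTime d n ω x y := by
  unfold geoPath
  rw [dif_pos hn]
  exact (exists_geodesic hn ω x y).choose_spec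

theorem isWalk_geoPath {d n : ℕ} (hn : 0 < Real.log n) (ω : Config d) (x y : ZVec d) :
    IsWalk x y (geoPath d n ω x y) :=
  let h := geoPath_spec hn ω x y
  ⟨h.1.2.2, h.2.1, h.2.2.1⟩

theorem passageTime_le_of_open {d n : ℕ} (hn : 1 ≤ Real.log n ^ 2) (hn0 : 0 < Real.log n)
    {ω ω' : Config d} {x y : ZVec d}
    (h : ∀ e ∈ pathEdges (geoPath d n ω x y), ω e = true → ω' e = true) :
    passageTime d n ω' x y ≤ passageTime d n ω x y := by
  rw [← (geoPath_spec hn0 ω x y).2.2.2]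
  exact (passageTime_le (isWalk_geoPath hn0 ω x y)).trans (pathCost_mono_of_open hn h)

theorem passageTime_setEdge_le {d n : ℕ} (hn0 : 0 < Real.log n) (ω : Config d) (e : EdgeD d)
    (x y : ZVec d) : passageTime d n (setEdge ω e false) x y ≤
      passageTime d n (setEdge ω e true) x y + Real.log n ^ 2 := by
  have h := geoPath_spec hn0 (setEdge ω e true) x y
  rw [← h.2.2.2]
  exact (passageTime_le (isWalk_geoPath hn0 _ x y)).trans (pathCost_setEdge_le h.1.2.1)

/-- Length of the geodesic, up to the minimal weight `c`. -/
theorem mul_length_geoPath_le {d n : ℕ} (hn0 : 0 < Real.log n) {c C : ℝ} (hc1 : c ≤ 1)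
    (hc : c ≤ Real.log n ^ 2) (hC1 : 1 ≤ C) (hC : Real.log n ^ 2 ≤ C) (ω : Config d)
    (x y : ZVec d) :
    c * (((geoPath d n ω x y).length - 1 : ℕ) : ℝ) ≤ C * norm1 d (x - y) := by
  refine (mul_length_le_pathCost (ω := ω) hc1 hc _).trans ?_
  rw [(geoPath_spec hn0 ω x y).2.2.2]
  exact passageTime_le_norm1 hC1 hC x y

theorem norm1_sub_head_le {d : ℕ} : ∀ {γ : List (ZVec d)} {x : ZVec d},
    γ.IsChain (Adj d) → γ.head? = some x → ∀ v ∈ γ, norm1 d (v - x) ≤ γ.length - 1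
  | [], x, _, h => by simp at h
  | [u], x, _, h => by
    obtain rfl : u = x := by simpa using h
    simp [norm1]
  | u :: w :: r, x, hc, h => by
    obtain rfl : u = x := by simpa using h
    have hc' := List.isChain_cons_cons.1 hc
    intro v hv
    rcases List.mem_cons.1 hv with rfl | hv
    · simp [norm1]
    · have h1 := norm1_sub_head_le hc'.2 rfl v hv
      have h2 := norm1_triangle v w u
      have h3 : norm1 d (w - u) = 1 := hc'.1.symm
      simp only [List.length_cons] at h1 ⊢
      omega

theorem finite_norm1_le {d : ℕ} (x : ZVec d) (K : ℕ) : {v : ZVec d | norm1 d (v - x) ≤ K}.Finite := by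
  refine (Set.finite_Icc (fun i => x i - K) (fun i => x i + K)).subset fun v hv => ?_
  have h : ∀ i, (v i - x i).natAbs ≤ K := fun i =>
    (Finset.single_le_sum (f := fun i => ((v - x) i).natAbs) (fun _ _ => Nat.zero_le _)
      (Finset.mem_univ i)).trans hv
  exact ⟨fun i => by have := h i; simp only; omega, fun i => by have := h i; simp only; omega⟩

theorem finite_edges_norm1_le {d : ℕ} (x : ZVec d) (K : ℕ) :
    {e : EdgeD d | norm1 d (e.val.1 - x) ≤ K ∧ norm1 d (e.val.2 - x) ≤ K}.Finite := by
  refine Set.Finite.of_injOn (f := Subtype.val) (t := {v : ZVec d | norm1 d (v - x) ≤ K} ×ˢ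
    {v : ZVec d | norm1 d (v - x) ≤ K}) (fun e he => ?_) Subtype.val_injective.injOn
    ((finite_norm1_le x K).prod (finite_norm1_le x K))
  exact he

theorem exists_dependsOn_passageTime {d n : ℕ} (hn0 : 0 < Real.log n) (x y : ZVec d) :
    ∃ B : Finset (EdgeD d), (∀ ω, pathEdges (geoPath d n ω x y) ⊆ B) ∧
      DependsOn (fun ω => passageTime d n ω x y) (B : Set (EdgeD d)) := by
  set c := min 1 (Real.log n ^ 2)
  set C := max 1 (Real.log n ^ 2)
  have hc0 : 0 < c := lt_min one_pos (by positivity)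
  set K := ⌊C * norm1 d (x - y) / c⌋₊
  have hB : ∀ ω, pathEdges (geoPath d n ω x y) ⊆ (finite_edges_norm1_le x K).toFinset := by
    intro ω e he
    have h1 := mul_length_geoPath_le (c := c) (C := C) hn0 (min_le_left ..) (min_le_right ..)
      (le_max_left ..) (le_max_right ..) ω x y
    have h2 : (geoPath d n ω x y).length - 1 ≤ K := by
      refine Nat.le_floor ?_
      rw [le_div_iff₀ hc0]
      linarith
    have hw := isWalk_geoPath hn0 ω x y
    have hm := mem_of_mem_pathEdges he
    rw [Set.Finite.mem_toFinset]
    exact ⟨(norm1_sub_head_le hw.1 hw.2.1 _ hm.1).trans h2,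
      (norm1_sub_head_le hw.1 hw.2.1 _ hm.2).trans h2⟩
  refine ⟨_, hB, ?_⟩
  have key : ∀ ω ω' : Config d, (∀ e ∈ (finite_edges_norm1_le x K).toFinset, ω e = ω' e) →
      passageTime d n ω' x y ≤ passageTime d n ω x y := by
    intro ω ω' h
    rw [← (geoPath_spec hn0 ω x y).2.2.2, pathCost_congr fun e he => h e (hB ω he)]
    exact passageTime_le (isWalk_geoPath hn0 ω x y)
  intro ω ω' h
  exact le_antisymm (key ω' ω fun e he => (h e he).symm) (key ω ω' h)

/-- `γ` minimises the path cost among all walks with the same endpoints. -/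
def IsGeo {d : ℕ} (n : ℕ) (ω : Config d) (γ : List (ZVec d)) : Prop :=
  γ.IsChain (Adj d) ∧ ∀ γ' : List (ZVec d), γ'.IsChain (Adj d) → γ'.head? = γ.head? →
    γ'.getLast? = γ.getLast? → pathCost d n ω γ ≤ pathCost d n ω γ'

theorem isGeo_geoPath {d n : ℕ} (hn : 0 < Real.log n) (ω : Config d) (x y : ZVec d) :
    IsGeo n ω (geoPath d n ω x y) := by
  have h := geoPath_spec hn ω x y
  refine ⟨h.1.2.2, fun γ' hc hh hl => ?_⟩
  rw [h.2.2.2]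
  exact passageTime_le ⟨hc, hh.trans h.2.1, hl.trans h.2.2.1⟩

theorem IsGeo.tail {d n : ℕ} {ω : Config d} {x : ZVec d} {r : List (ZVec d)}
    (h : IsGeo n ω (x :: r)) : IsGeo n ω r := by
  cases r with
  | nil => exact ⟨List.IsChain.nil, fun γ' _ _ _ => pathCost_nonneg γ'⟩
  | cons y t =>
    have hc := List.isChain_cons_cons.1 h.1
    refine ⟨hc.2, fun γ' h1 h2 h3 => ?_⟩
    cases γ' with
    | nil => simp at h2
    | cons z s =>
      obtain rfl : z = y := by simpa using h2
      have := h.2 (x :: z :: s) (List.isChain_cons_cons.2 ⟨hc.1, h1⟩) rfl (by simpa using h3)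
      simp only [pathCost] at this ⊢
      linarith

theorem IsGeo.reverse {d n : ℕ} {ω : Config d} {γ : List (ZVec d)} (h : IsGeo n ω γ) :
    IsGeo n ω γ.reverse := by
  refine ⟨List.isChain_reverse.2 (h.1.imp fun a b hab => hab.symm), fun γ' h1 h2 h3 => ?_⟩
  rw [pathCost_reverse, ← pathCost_reverse γ']
  refine h.2 _ (List.isChain_reverse.2 (h1.imp fun a b hab => hab.symm)) ?_ ?_
  · rw [List.head?_reverse, h3, List.getLast?_reverse]
  · rw [List.getLast?_reverse, h2, List.head?_reverse]

theorem IsGeo.exists_trim {d n : ℕ} {ω : Config d} (Q : Set (ZVec d)) : ∀ {γ : List (ZVec d)},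
    IsGeo n ω γ → ∃ s, IsGeo n ω s ∧ (∀ u, s.head? = some u → u ∈ Q) ∧
      (∀ v, s.getLast? = some v → γ.getLast? = some v) ∧
      ∀ e ∈ pathEdges γ, e.val.1 ∈ Q → e.val.2 ∈ Q → e ∈ pathEdges s
  | [], h => ⟨[], h, by simp, by simp, fun e he _ _ => he⟩
  | x :: r, h => by
    by_cases hx : x ∈ Q
    · exact ⟨x :: r, h, by simpa using hx, fun v hv => hv, fun e he _ _ => he⟩
    · obtain ⟨s, h1, h2, h3, h4⟩ := h.tail.exists_trim Q
      refine ⟨s, h1, h2, fun v hv => ?_, fun e he he1 he2 => h4 e ?_ he1 he2⟩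
      · have := h3 v hv
        cases r with
        | nil => simp at this
        | cons y t => simpa using this
      · cases r with
        | nil => simp [pathEdges] at he
        | cons y t =>
          rw [pathEdges, Finset.mem_union, mem_linkEdges] at he
          rcases he with (he | he) | he
          · simp [he] at he1; exact absurd he1 hx
          · simp [he] at he2; exact absurd he2 hx
          · exact he

/-- A geodesic cannot have many edges inside a set of small diameter. -/
theorem IsGeo.card_edges_in_le {d n : ℕ} (hn : 1 ≤ Real.log n ^ 2) {ω : Config d}
    (Q : Set (ZVec d)) {D : ℕ} (hQ : ∀ u ∈ Q, ∀ v ∈ Q, norm1 d (u - v) ≤ D) {γ : List (ZVec d)} (h : IsGeo n ω γ) :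
    (((pathEdges γ).filter fun e => e.val.1 ∈ Q ∧ e.val.2 ∈ Q).card : ℝ) ≤
      Real.log n ^ 2 * D := by
  obtain ⟨s, hs, hs1, -, hs3⟩ := h.exists_trim Q
  obtain ⟨t, ht, ht1, ht2, ht3⟩ := hs.reverse.exists_trim Q
  have hsub : ((pathEdges γ).filter fun e => e.val.1 ∈ Q ∧ e.val.2 ∈ Q) ⊆ pathEdges t := by
    intro e he
    rw [Finset.mem_filter] at he
    refine ht3 e ?_ he.2.1 he.2.2
    rw [pathEdges_reverse]
    exact hs3 e he.1 he.2.1 he.2.2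
  have h1 : (((pathEdges γ).filter fun e => e.val.1 ∈ Q ∧ e.val.2 ∈ Q).card : ℝ) ≤
      pathCost d n ω t := by
    have h2 := mul_length_le_pathCost (ω := ω) le_rfl hn t
    rw [one_mul] at h2
    refine le_trans ?_ h2
    exact_mod_cast (Finset.card_le_card hsub).trans (card_pathEdges_le t)
  refine h1.trans ?_
  rcases t.eq_nil_or_concat with rfl | ⟨t', v, hv⟩
  · simp only [pathCost]; positivity
  · have hlast : t.getLast? = some v := by simp [hv]
    have hvQ : v ∈ Q := by
      have := ht2 v hlast
      rw [List.getLast?_reverse] at this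
      exact hs1 v this
    obtain ⟨u, hu⟩ : ∃ u, t.head? = some u := by
      cases t with
      | nil => simp at hlast
      | cons u r => exact ⟨u, rfl⟩
    have huQ := ht1 u hu
    obtain ⟨η, hη, hl⟩ := exists_isWalk _ u v rfl
    refine (ht.2 η hη.1 (hη.2.1.trans hu.symm) (hη.2.2.trans hlast.symm)).trans
      ((pathCost_le_mul_length hn le_rfl η).trans ?_)
    rw [hl, Nat.add_sub_cancel]
    exact mul_le_mul_of_nonneg_left (by exact_mod_cast hQ u huQ v hvQ) (by positivity)

theorem Adj.add_right {d : ℕ} {x y : ZVec d} (h : Adj d x y) (z : ZVec d) :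
    Adj d (x + z) (y + z) := by
  unfold Adj at h ⊢
  rwa [add_sub_add_right_eq_sub]

/-- The translate of an edge. -/
def shiftEdge {d : ℕ} (z : ZVec d) (e : EdgeD d) : EdgeD d :=
  ((joins_endpoints e).adj.add_right z).exists_joins.choose

theorem shiftEdge_joins {d : ℕ} (z : ZVec d) {e : EdgeD d} {x y : ZVec d} (h : Joins e x y) :
    Joins (shiftEdge z e) (x + z) (y + z) := by
  have h' : Joins (shiftEdge z e) (e.val.1 + z) (e.val.2 + z) :=
    ((joins_endpoints e).adj.add_right z).exists_joins.choose_spec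
  rcases h with h | h
  · simpa [h] using h'
  · simpa [h] using h'.symm

theorem shiftEdge_neg_shiftEdge {d : ℕ} (z : ZVec d) (e : EdgeD d) :
    shiftEdge (-z) (shiftEdge z e) = e := by
  have := shiftEdge_joins (-z) (shiftEdge_joins z (joins_endpoints e))
  rw [add_neg_cancel_right, add_neg_cancel_right] at this
  exact this.eq (joins_endpoints e)

/-- Translation by `z` as a permutation of the edges. -/
def shiftEquiv {d : ℕ} (z : ZVec d) : EdgeD d ≃ EdgeD d where
  toFun := shiftEdge z
  invFun := shiftEdge (-z)
  left_inv := shiftEdge_neg_shiftEdge z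
  right_inv e := by simpa using shiftEdge_neg_shiftEdge (-z) e

theorem edgeOpen_comp_shiftEquiv {d : ℕ} (z : ZVec d) {ω : Config d} {x y : ZVec d} :
    EdgeOpen d (ω ∘ shiftEquiv z) x y ↔ EdgeOpen d ω (x + z) (y + z) := by
  constructor
  · rintro ⟨e, he, ho⟩
    exact ⟨shiftEdge z e, shiftEdge_joins z he, ho⟩
  · rintro ⟨e, he, ho⟩
    refine ⟨shiftEdge (-z) e, ?_, ?_⟩
    · simpa [Joins] using shiftEdge_joins (-z) he
    · have := (shiftEquiv z).apply_symm_apply e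
      change shiftEdge z (shiftEdge (-z) e) = e at this
      simpa [shiftEquiv, this] using ho

theorem pathCost_map_add {d n : ℕ} (z : ZVec d) {ω : Config d} : ∀ γ : List (ZVec d),
    pathCost d n ω (γ.map (· + z)) = pathCost d n (ω ∘ shiftEquiv z) γ
  | [] => rfl
  | [_] => rfl
  | x :: y :: r => by
    have := pathCost_map_add (n := n) z (ω := ω) (y :: r)
    simp only [List.map_cons, pathCost, pairWeight, edgeOpen_comp_shiftEquiv] at this ⊢
    rw [this]

theorem IsWalk.map_add {d : ℕ} {x y : ZVec d} {γ : List (ZVec d)} (h : IsWalk x y γ) (z : ZVec d) :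
    IsWalk (x + z) (y + z) (γ.map (· + z)) := by
  refine ⟨(List.isChain_map _).2 (h.1.imp fun a b hab => hab.add_right z), ?_, ?_⟩
  · simp [h.2.1]
  · simp [h.2.2]

theorem passageTime_add {d n : ℕ} (hn : 0 < Real.log n) (z : ZVec d) (ω : Config d)
    (x y : ZVec d) :
    passageTime d n ω (x + z) (y + z) = passageTime d n (ω ∘ shiftEquiv z) x y := by
  have key : ∀ (z x y : ZVec d) (ω : Config d),
      passageTime d n ω (x + z) (y + z) ≤ passageTime d n (ω ∘ shiftEquiv z) x y := by
    intro z x y ω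
    rw [← (geoPath_spec hn (ω ∘ shiftEquiv z) x y).2.2.2, ← pathCost_map_add]
    exact passageTime_le ((isWalk_geoPath hn _ x y).map_add z)
  refine le_antisymm (key z x y ω) ?_
  have := key (-z) (x + z) (y + z) (ω ∘ shiftEquiv z)
  rw [add_neg_cancel_right, add_neg_cancel_right] at this
  refine this.trans (le_of_eq ?_)
  congr 1
  funext e
  exact congrArg ω ((shiftEquiv z).apply_symm_apply e)

/-- `E ω` is a set of edges certifying upper bounds for the monotone functional `T`, which moreover
changes by at most `L` when one edge is switched. -/
structure Certified {d : ℕ} (T : Config d → ℝ) (E : Config d → Finset (EdgeD d)) (L : ℝ) : Prop where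
  cert : ∀ ω ω' : Config d, (∀ e ∈ E ω, ω e = true → ω' e = true) → T ω' ≤ T ω
  lip : ∀ ω e, T (setEdge ω e false) ≤ T (setEdge ω e true) + L

namespace Certified

variable {d : ℕ} {T : Config d → ℝ} {E : Config d → Finset (EdgeD d)} {L : ℝ}

theorem anti (h : Certified T E L) {ω ω' : Config d} (hω : ∀ e, ω e = true → ω' e = true) :
    T ω' ≤ T ω := h.cert ω ω' fun e _ => hω e

theorem setEdge_anti (h : Certified T E L) (ω : Config d) (e : EdgeD d) :
    T (setEdge ω e true) ≤ T (setEdge ω e false) := by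
  refine h.anti fun e' he' => ?_
  by_cases hee : e' = e
  · subst hee; simp
  · rwa [setEdge_of_ne _ hee] at he' ⊢

theorem influence_eq (h : Certified T E L) (ω : Config d) (e : EdgeD d) :
    influence T e ω = T (setEdge ω e false) - T (setEdge ω e true) := by
  rw [influence, abs_sub_comm, abs_of_nonneg (sub_nonneg.2 (h.setEdge_anti ω e))]

theorem influence_le (h : Certified T E L) (ω : Config d) (e : EdgeD d) :
    influence T e ω ≤ L := by
  rw [h.influence_eq]
  linarith [h.lip ω e]

theorem influence_eq_zero (h : Certified T E L) {ω : Config d} {e : EdgeD d}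
    (he : e ∉ E (setEdge ω e true)) : influence T e ω = 0 := by
  rw [h.influence_eq]
  refine le_antisymm (sub_nonpos.2 (h.cert _ _ fun e' he' ho => ?_))
    (sub_nonneg.2 (h.setEdge_anti ω e))
  have : e' ≠ e := fun hh => he (hh ▸ he')
  rwa [setEdge_of_ne _ this] at ho ⊢

theorem influence_open_le (h : Certified T E L) (hL : 0 ≤ L) (ω : Config d) (e : EdgeD d) :
    (if ω e = true then influence T e ω else 0) ≤ if e ∈ E ω then L else 0 := by
  split_ifs with h1 h2 h2
  · exact h.influence_le ω e
  · have : setEdge ω e true = ω := by rw [← h1]; exact Function.update_eq_self ..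
    exact (h.influence_eq_zero (by rwa [this])).le
  · exact hL
  · exact le_rfl

end Certified

theorem certified_passageTime {d n : ℕ} (hn : 1 ≤ Real.log n ^ 2) (hn0 : 0 < Real.log n)
    (x y : ZVec d) :
    Certified (fun ω => passageTime d n ω x y) (fun ω => pathEdges (geoPath d n ω x y))
      (Real.log n ^ 2) :=
  ⟨fun _ _ h => passageTime_le_of_open hn hn0 h,
    fun ω e => passageTime_setEdge_le hn0 ω e x y⟩

theorem dependsOn_ite_open {d : ℕ} {D : Config d → ℝ} {B : Finset (EdgeD d)}
    (hD : DependsOn D (B : Set (EdgeD d))) (e : EdgeD d) :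
    DependsOn (fun ω => if ω e = true then D ω else 0)
      ((insert e B : Finset (EdgeD d)) : Set (EdgeD d)) := by
  intro ω ω' h
  have h1 : ω e = ω' e := h e (by simp)
  have h2 : D ω = D ω' := hD fun e' he' => h e' (by simp at he' ⊢; exact Or.inr he')
  simp only [h1, h2]

theorem IsBernoulli.mul_integral_influence {d : ℕ} {p : ℝ} {μ : Measure (Config d)}
    (hμ : IsBernoulli d p μ) (hp0 : 0 ≤ p) (hp1 : p ≤ 1) (e : EdgeD d) {T : Config d → ℝ}
    {B : Finset (EdgeD d)} (hT : DependsOn T (B : Set (EdgeD d))) :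
    p * ∫ ω, influence T e ω ∂μ = ∫ ω, (if ω e = true then influence T e ω else 0) ∂μ := by
  rw [hμ.integral_resampleMean hp0 hp1 e (dependsOn_ite_open (dependsOn_influence hT e) e),
    ← integral_const_mul]
  refine integral_congr_ae (Filter.Eventually.of_forall fun ω => ?_)
  simp [resampleMean, influence_setEdge]

theorem influence_comp_equiv {d : ℕ} (T : Config d → ℝ) (σ : EdgeD d ≃ EdgeD d) (e : EdgeD d)
    (ω : Config d) :
    influence (fun ω => T (ω ∘ σ)) e ω = influence T (σ.symm e) (ω ∘ σ) := by
  have : ∀ b, setEdge ω e b ∘ σ = setEdge (ω ∘ σ) (σ.symm e) b := fun b => by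
    funext e'
    by_cases h : σ e' = e
    · have h' : e' = σ.symm e := by simp [← h]
      subst h'
      simp
    · have h' : e' ≠ σ.symm e := fun hh => h (by simp [hh])
      rw [Function.comp_apply, setEdge_of_ne _ h, setEdge_of_ne _ h', Function.comp_apply]
  simp only [influence, this]

theorem IsBernoulli.integral_influence_shift {d n : ℕ} {p : ℝ} {μ : Measure (Config d)}
    (hμ : IsBernoulli d p μ) (hn : 0 < Real.log n) (x y z : ZVec d) (e : EdgeD d) :
    ∫ ω, influence (fun ω => passageTime d n ω (x + z) (y + z)) e ω ∂μ =
      ∫ ω, influence (fun ω => passageTime d n ω x y) (shiftEdge (-z) e) ω ∂μ := by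
  simp only [passageTime_add hn]
  have h1 : ∀ ω, influence (fun ω => passageTime d n (ω ∘ shiftEquiv z) x y) e ω =
      influence (fun ω => passageTime d n ω x y) (shiftEdge (-z) e) (ω ∘ shiftEquiv z) := fun ω =>
    influence_comp_equiv (fun ω => passageTime d n ω x y) (shiftEquiv z) e ω
  simp only [h1]
  obtain ⟨B, -, hB⟩ := exists_dependsOn_passageTime (d := d) hn x y
  have hm : Measurable fun ω : Config d => ω ∘ shiftEquiv z :=
    measurable_pi_lambda _ fun e => measurable_pi_apply _
  conv_rhs => rw [← hμ.map_comp_equiv (shiftEquiv z)]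
  rw [integral_map hm.aemeasurable
    (measurable_of_dependsOn (dependsOn_influence hB _)).aestronglyMeasurable]

theorem shiftEdge_neg_injective {d : ℕ} (e : EdgeD d) :
    Function.Injective fun z : ZVec d => shiftEdge (-z) e := by
  intro z z' h
  have h1 := shiftEdge_joins (-z) (joins_endpoints e)
  have h2 := shiftEdge_joins (-z') (joins_endpoints e)
  simp only at h
  rw [h] at h1
  have hne : e.val.1 ≠ e.val.2 := fun hh => (joins_endpoints e).adj.norm1_ne (by rw [hh])
  have key : e.val.1 + -z = e.val.1 + -z' ∨
      (e.val.1 + -z = e.val.2 + -z' ∧ e.val.2 + -z = e.val.1 + -z') := by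
    rcases h1 with h1 | h1 <;> rcases h2 with h2 | h2 <;> rw [h1] at h2 <;>
      simp only [Prod.mk.injEq] at h2
    · exact Or.inl h2.1
    · exact Or.inr h2
    · exact Or.inr ⟨h2.2, h2.1⟩
    · exact Or.inl h2.2
  rcases key with key | ⟨k1, k2⟩
  · simpa using key
  · refine absurd ?_ hne
    funext i
    have e1 := congrFun k1 i
    have e2 := congrFun k2 i
    simp only [Pi.add_apply, Pi.neg_apply] at e1 e2
    omega

theorem Adj.natAbs_sub_le {d : ℕ} {x y : ZVec d} (h : Adj d x y) (i : Fin d) :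
    (x i - y i).natAbs ≤ 1 := by
  have h' : norm1 d (x - y) = 1 := h
  rw [← h']
  exact Finset.single_le_sum (f := fun i => ((x - y) i).natAbs) (fun _ _ => Nat.zero_le _)
    (Finset.mem_univ i)

theorem IsBernoulli.sum_integral_influence_le {d n : ℕ} {p : ℝ} {μ : Measure (Config d)}
    (hμ : IsBernoulli d p μ) (hp0 : 0 < p) (hp1 : p ≤ 1) (hn : 1 ≤ Real.log n ^ 2)
    (hn0 : 0 < Real.log n) (y : ZVec d) (m : ℕ) (e : EdgeD d) :
    ∑ z ∈ boxFinset d m, ∫ ω, influence (fun ω => passageTime d n ω z (z + y)) e ω ∂μ ≤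
      2 * d / p * (Real.log n ^ 2) ^ 2 * (m + 1) := by
  have := hμ.1
  set L := Real.log n ^ 2 with hL
  set T : Config d → ℝ := fun ω => passageTime d n ω 0 y with hT
  obtain ⟨B, -, hB⟩ := exists_dependsOn_passageTime (d := d) hn0 0 y
  have hcert := certified_passageTime hn hn0 (0 : ZVec d) y
  have h1 : ∀ z, ∫ ω, influence (fun ω => passageTime d n ω z (z + y)) e ω ∂μ =
      ∫ ω, influence T (shiftEdge (-z) e) ω ∂μ := fun z => by
    have := hμ.integral_influence_shift hn0 0 y z e
    rwa [zero_add, add_comm y z] at this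
  simp only [h1]
  set Q : Set (ZVec d) := {v | ∀ i, (v i - e.val.1 i).natAbs ≤ m + 1} with hQ
  have hQd : ∀ u ∈ Q, ∀ v ∈ Q, norm1 d (u - v) ≤ d * (2 * (m + 1)) := by
    intro u hu v hv
    calc norm1 d (u - v) ≤ ∑ _i : Fin d, 2 * (m + 1) := Finset.sum_le_sum fun i _ => by
          have h1 := hu i
          have h2 := hv i
          simp only [Pi.sub_apply]
          omega
      _ = _ := by simp
  have hpt : ∀ ω, ∑ z ∈ boxFinset d m, (if ω (shiftEdge (-z) e) = true then
      influence T (shiftEdge (-z) e) ω else 0) ≤ L * (L * (d * (2 * (m + 1)) : ℕ)) := by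
    intro ω
    set γ := geoPath d n ω 0 y
    calc _ ≤ ∑ z ∈ boxFinset d m, if shiftEdge (-z) e ∈ pathEdges γ then L else 0 :=
          Finset.sum_le_sum fun z _ => hcert.influence_open_le (by linarith) ω _
      _ = L * ((boxFinset d m).filter fun z => shiftEdge (-z) e ∈ pathEdges γ).card := by
          rw [← Finset.sum_filter, Finset.sum_const, nsmul_eq_mul, mul_comm]
      _ ≤ L * (((pathEdges γ).filter fun e' => e'.val.1 ∈ Q ∧ e'.val.2 ∈ Q).card : ℝ) := by
          refine mul_le_mul_of_nonneg_left ?_ (by linarith)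
          rw [Nat.cast_le]
          refine Finset.card_le_card_of_injOn (fun z => shiftEdge (-z) e) (fun z hz => ?_)
            (shiftEdge_neg_injective e).injOn
          have hz := Finset.mem_filter.1 hz
          rw [boxFinset, Finset.mem_Icc] at hz
          have hadj := (joins_endpoints e).adj
          have k1 : e.val.1 + -z ∈ Q := fun i => by
            have h1 := hz.1.1 i
            have h2 := hz.1.2 i
            simp only [Pi.add_apply, Pi.neg_apply] at h1 h2 ⊢
            omega
          have k2 : e.val.2 + -z ∈ Q := fun i => by
            have h1 := hz.1.1 i
            have h2 := hz.1.2 i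
            have h3 := hadj.natAbs_sub_le i
            simp only [Pi.add_apply, Pi.neg_apply] at h1 h2 ⊢
            omega
          refine Finset.mem_coe.2 (Finset.mem_filter.2 ⟨hz.2, ?_⟩)
          rcases shiftEdge_joins (-z) (joins_endpoints e) with h | h
          · simp only [h]; exact ⟨k1, k2⟩
          · simp only [h]; exact ⟨k2, k1⟩
      _ ≤ _ := by
          refine mul_le_mul_of_nonneg_left ?_ (by linarith)
          refine le_trans (le_of_eq ?_) ((isGeo_geoPath hn0 ω 0 y).card_edges_in_le hn Q hQd)
          congr!
  have h2 : p * ∑ z ∈ boxFinset d m, ∫ ω, influence T (shiftEdge (-z) e) ω ∂μ ≤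
      L * (L * (d * (2 * (m + 1)) : ℕ)) := by
    rw [Finset.mul_sum]
    have h3 : ∀ z, p * ∫ ω, influence T (shiftEdge (-z) e) ω ∂μ =
        ∫ ω, (if ω (shiftEdge (-z) e) = true then influence T (shiftEdge (-z) e) ω else 0) ∂μ :=
      fun z => hμ.mul_integral_influence hp0.le hp1 _ hB
    simp only [h3]
    have hint : ∀ z ∈ boxFinset d m, Integrable (fun ω => if ω (shiftEdge (-z) e) = true then
        influence T (shiftEdge (-z) e) ω else 0) μ := fun z _ =>
      integrable_of_dependsOn (dependsOn_ite_open (dependsOn_influence hB _) _)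
    rw [← integral_finsetSum _ hint]
    refine (integral_mono (integrable_finsetSum _ hint) (integrable_const _) hpt).trans ?_
    simp
  have h3 : 2 * d / p * L ^ 2 * (m + 1) = (L * (L * (d * (2 * (m + 1)) : ℕ))) / p := by
    push_cast; ring
  rw [h3, le_div_iff₀ hp0]
  linarith

/-- The probability that a `θ`-random subset of `B` equals `R`. -/
def subsetWeight {ι : Type*} (θ : ℝ) (B R : Finset ι) : ℝ :=
  θ ^ R.card * (1 - θ) ^ (B \ R).card

theorem subsetWeight_nonneg {ι : Type*} {θ : ℝ} (h0 : 0 ≤ θ) (h1 : θ ≤ 1) (B R : Finset ι) :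
    0 ≤ subsetWeight θ B R :=
  mul_nonneg (pow_nonneg h0 _) (pow_nonneg (sub_nonneg.2 h1) _)

theorem sum_subsetWeight {ι : Type*} (θ : ℝ) (B : Finset ι) :
    ∑ R ∈ B.powerset, subsetWeight θ B R = 1 := by
  have := Finset.prod_add (fun _ : ι => θ) (fun _ => 1 - θ) B
  simp only [Finset.prod_const, add_sub_cancel, one_pow] at this
  rw [this]
  rfl

theorem sum_powerset_insert_subsetWeight {ι : Type*} {θ : ℝ} {a : ι} {R : Finset ι} (ha : a ∉ R)
    (f : Finset ι → ℝ) :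
    ∑ O ∈ (insert a R).powerset, subsetWeight θ (insert a R) O * f O =
      ∑ O ∈ R.powerset, subsetWeight θ R O * (θ * f (insert a O) + (1 - θ) * f O) := by
  rw [Finset.sum_powerset_insert ha, add_comm, ← Finset.sum_add_distrib]
  refine Finset.sum_congr rfl fun O hO => ?_
  have hO := Finset.mem_powerset.1 hO
  have haO : a ∉ O := fun h => ha (hO h)
  have h1 : insert a R \ insert a O = R \ O := by
    ext x; simp only [Finset.mem_sdiff, Finset.mem_insert]
    by_cases hx : x = a
    · subst hx; simp [ha]
    · simp [hx]
  have h2 : insert a R \ O = insert a (R \ O) := by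
    ext x; simp only [Finset.mem_sdiff, Finset.mem_insert]
    by_cases hx : x = a
    · subst hx; simp [haO]
    · simp [hx]
  have h3 : a ∉ R \ O := fun h => ha (Finset.mem_sdiff.1 h).1
  simp only [subsetWeight, h1, h2, Finset.card_insert_of_notMem haO,
    Finset.card_insert_of_notMem h3]
  ring

/-- The number of elements of `R` lying strictly below every element of `O`. -/
def belowCount {ι : Type*} (V : ι → ℝ) (R O : Finset ι) : ℕ :=
  (R.filter fun a => ∀ b ∈ O, V a < V b).card

theorem sum_subsetWeight_pow_belowCount_le {ι : Type*} {p r : ℝ} (hp0 : 0 ≤ p) (hp1 : p ≤ 1)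
    (hr1 : 1 ≤ r) (hr : (1 - p) * r < 1) (V : ι → ℝ) (R : Finset ι) :
    ∑ O ∈ R.powerset, subsetWeight p R O * r ^ belowCount V R O ≤ 1 / (1 - (1 - p) * r) := by
  have hc : 0 < 1 - (1 - p) * r := by linarith
  have hq : 0 ≤ (1 - p) * r := mul_nonneg (by linarith) (by linarith)
  induction hk : R.card generalizing R with
  | zero =>
    obtain rfl := Finset.card_eq_zero.1 hk
    simp only [Finset.powerset_empty, Finset.sum_singleton, subsetWeight, belowCount,
      Finset.filter_empty, Finset.card_empty, pow_zero, Finset.sdiff_self, mul_one]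
    rw [le_div_iff₀ hc]
    linarith
  | succ k ih =>
    obtain ⟨a, haR, hmin⟩ := Finset.exists_min_image R V
      (Finset.card_pos.1 (by omega))
    obtain ⟨R', ha, rfl⟩ : ∃ R', a ∉ R' ∧ insert a R' = R :=
      ⟨R.erase a, Finset.notMem_erase a R, Finset.insert_erase haR⟩
    rw [Finset.card_insert_of_notMem ha] at hk
    rw [sum_powerset_insert_subsetWeight ha fun O => r ^ belowCount V (insert a R') O]
    have h1 : ∀ O, belowCount V (insert a R') (insert a O) = 0 := fun O => by
      rw [belowCount, Finset.card_eq_zero, Finset.filter_eq_empty_iff]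
      intro b hb h
      exact absurd (h a (Finset.mem_insert_self a O)) (not_lt.2 (hmin b hb))
    have h2 : ∀ O, belowCount V (insert a R') O ≤ belowCount V R' O + 1 := fun O => by
      refine (Finset.card_le_card (t := insert a (R'.filter fun a => ∀ b ∈ O, V a < V b))
        fun x hx => ?_).trans (Finset.card_insert_le _ _)
      simp only [Finset.mem_filter, Finset.mem_insert] at hx ⊢
      tauto
    calc _ ≤ ∑ O ∈ R'.powerset, subsetWeight p R' O *
            (p + (1 - p) * r * r ^ belowCount V R' O) := by
          refine Finset.sum_le_sum fun O _ => ?_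
          refine mul_le_mul_of_nonneg_left ?_ (subsetWeight_nonneg hp0 hp1 _ _)
          have := pow_le_pow_right₀ hr1 (h2 O)
          rw [pow_succ'] at this
          rw [h1, pow_zero, mul_one, mul_assoc]
          have := mul_le_mul_of_nonneg_left this (by linarith : 0 ≤ 1 - p)
          linarith
      _ = p + (1 - p) * r * ∑ O ∈ R'.powerset, subsetWeight p R' O * r ^ belowCount V R' O := by
          simp only [mul_add, Finset.sum_add_distrib, ← Finset.sum_mul, sum_subsetWeight,
            Finset.mul_sum]
          rw [one_mul]
          congr 1
          exact Finset.sum_congr rfl fun O _ => by ring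
      _ ≤ 1 + (1 - p) * r * (1 / (1 - (1 - p) * r)) :=
          add_le_add hp1 (mul_le_mul_of_nonneg_left (ih R' (by omega)) hq)
      _ = _ := by field_simp; ring

theorem exists_pow_four_le {r : ℝ} (hr : 1 < r) : ∃ C : ℝ, 0 < C ∧ ∀ j : ℕ, (j : ℝ) ^ 4 ≤ C * r ^ j := by
  have h := tendsto_pow_const_mul_const_pow_of_lt_one 4 (inv_nonneg.2 (by linarith : 0 ≤ r))
    (inv_lt_one_of_one_lt₀ hr)
  obtain ⟨C, hC⟩ := h.bddAbove_range
  refine ⟨max C 1, by positivity, fun j => ?_⟩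
  have h1 : (j : ℝ) ^ 4 * r⁻¹ ^ j ≤ C := hC ⟨j, rfl⟩
  have h2 : 0 < r ^ j := pow_pos (by linarith) j
  rw [inv_pow, ← div_eq_mul_inv, div_le_iff₀ h2] at h1
  exact h1.trans (mul_le_mul_of_nonneg_right (le_max_left _ _) h2.le)

theorem exists_sum_subsetWeight_belowCount_le {p : ℝ} (hp0 : 0 < p) (hp1 : p < 1) :
    ∃ C : ℝ, 0 < C ∧ ∀ {ι : Type} (V : ι → ℝ) (R : Finset ι),
      ∑ O ∈ R.powerset, subsetWeight p R O * (belowCount V R O : ℝ) ^ 4 ≤ C := by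
  have hr : 1 < 2 / (2 - p) := by rw [lt_div_iff₀ (by linarith)]; linarith
  have hr' : (1 - p) * (2 / (2 - p)) < 1 := by
    rw [← mul_div_assoc, div_lt_one (by linarith)]; linarith
  obtain ⟨C, hC0, hC⟩ := exists_pow_four_le hr
  refine ⟨C * (1 / (1 - (1 - p) * (2 / (2 - p)))),
    mul_pos hC0 (one_div_pos.2 (by linarith)), fun V R => ?_⟩
  refine le_trans ?_ (mul_le_mul_of_nonneg_left
    (sum_subsetWeight_pow_belowCount_le hp0.le hp1.le hr.le hr' V R) hC0.le)
  rw [Finset.mul_sum]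
  refine Finset.sum_le_sum fun O _ => ?_
  have := mul_le_mul_of_nonneg_left (hC (belowCount V R O))
    (subsetWeight_nonneg hp0.le hp1.le R O)
  linarith

/-- A sparse random set meets a given set of size at most `w` exactly in a given point with
probability of order at least `1 / w`. -/
theorem one_le_sum_subsetWeight_inter {ι : Type*} {w : ℕ} (hw : 1 ≤ w) {B t : Finset ι} {a : ι}
    (haB : a ∈ B) (ht : t.card ≤ w) :
    1 ≤ 4 * (w : ℝ) * ∑ R ∈ B.powerset,
      subsetWeight (1 / (2 * w)) B R * if a ∈ R ∧ (∀ b ∈ R, b ∈ t → b = a) then 1 else 0 := by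
  have hw' : (1 : ℝ) ≤ w := by exact_mod_cast hw
  set θ : ℝ := 1 / (2 * w) with hθ
  have hθ0 : 0 ≤ θ := by positivity
  have hθw : θ * w = 1 / 2 := by rw [hθ]; field_simp
  have hθ1 : θ ≤ 1 := by nlinarith
  let f : ι → ℝ := fun i => if i ∈ t ∧ i ≠ a then 0 else θ
  let g : ι → ℝ := fun i => if i = a then 0 else 1 - θ
  have hf : ∀ i, 0 ≤ f i ∧ f i ≤ θ := fun i => by
    simp only [f]; split_ifs <;> exact ⟨by linarith, by linarith⟩
  have hg : ∀ i, 0 ≤ g i ∧ g i ≤ 1 - θ := fun i => by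
    simp only [g]; split_ifs <;> exact ⟨by linarith, by linarith⟩
  have h1 : ∏ i ∈ B, (f i + g i) ≤ ∑ R ∈ B.powerset,
      subsetWeight θ B R * if a ∈ R ∧ (∀ b ∈ R, b ∈ t → b = a) then 1 else 0 := by
    rw [Finset.prod_add]
    refine Finset.sum_le_sum fun R _ => ?_
    split_ifs with h
    · rw [mul_one, subsetWeight, ← Finset.prod_const, ← Finset.prod_const]
      refine mul_le_mul (Finset.prod_le_prod (fun i _ => (hf i).1) fun i _ => (hf i).2)
        (Finset.prod_le_prod (fun i _ => (hg i).1) fun i _ => (hg i).2)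
        (Finset.prod_nonneg fun i _ => (hg i).1) (Finset.prod_nonneg fun i _ => hθ0)
    · rw [mul_zero]
      refine le_of_eq ?_
      by_cases haR : a ∈ R
      · obtain ⟨b, hb, hbt, hba⟩ : ∃ b ∈ R, b ∈ t ∧ b ≠ a := by
          by_contra hcon
          push Not at hcon
          exact h ⟨haR, hcon⟩
        rw [Finset.prod_eq_zero hb (by simp [f, hbt, hba]), zero_mul]
      · rw [Finset.prod_eq_zero (Finset.mem_sdiff.2 ⟨haB, haR⟩) (by simp [g]), mul_zero]
  have h2 : θ * (1 - θ) ^ w ≤ ∏ i ∈ B, (f i + g i) := by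
    rw [← Finset.mul_prod_erase B _ haB]
    have h3 : f a + g a = θ := by simp [f, g]
    rw [h3]
    refine mul_le_mul_of_nonneg_left ?_ hθ0
    calc (1 - θ) ^ w ≤ (1 - θ) ^ ((B.erase a).filter (· ∈ t)).card := by
          refine pow_le_pow_of_le_one (by linarith) (by linarith) ?_
          exact (Finset.card_le_card fun x hx => (Finset.mem_filter.1 hx).2).trans ht
      _ = ∏ i ∈ B.erase a, if i ∈ t then 1 - θ else 1 := by
          rw [← Finset.prod_filter, Finset.prod_const]
      _ = _ := by
          refine Finset.prod_congr rfl fun i hi => ?_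
          have := Finset.ne_of_mem_erase hi
          by_cases hit : i ∈ t <;> simp [f, g, this, hit]
  have h3 : 1 / 2 ≤ (1 - θ) ^ w := by
    have := one_add_mul_le_pow (a := -θ) (by linarith) w
    rw [← sub_eq_add_neg] at this
    linarith
  calc (1 : ℝ) = 4 * w * (θ * (1 / 2)) := by linarith
    _ ≤ 4 * w * (θ * (1 - θ) ^ w) := by gcongr
    _ ≤ _ := mul_le_mul_of_nonneg_left (h2.trans h1) (by positivity)

/-- The configuration whose open edges inside `R` are exactly those of `O`, equal to `ω` outside
`R`. -/
def setOn {d : ℕ} (ω : Config d) (R O : Finset (EdgeD d)) : Config d :=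
  fun e => if e ∈ R then decide (e ∈ O) else ω e

theorem setOn_setOn {d : ℕ} (ω : Config d) (R O O' : Finset (EdgeD d)) :
    setOn (setOn ω R O) R O' = setOn ω R O' := by
  funext e
  by_cases h : e ∈ R <;> simp [setOn, h]

theorem dependsOn_setOn {d : ℕ} {β : Type*} {G : Config d → β} {B : Set (EdgeD d)}
    (hG : DependsOn G B) (R O : Finset (EdgeD d)) : DependsOn (fun ω => G (setOn ω R O)) B := by
  intro ω ω' h
  refine hG fun e he => ?_
  simp only [setOn, h e he]

theorem setOn_setEdge_true {d : ℕ} (ω : Config d) {R O : Finset (EdgeD d)} {e : EdgeD d}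
    (he : e ∉ R) : setOn (setEdge ω e true) R O = setOn ω (insert e R) (insert e O) := by
  funext e'
  by_cases h : e' = e
  · subst h; simp [setOn, he]
  · simp [setOn, h]

theorem setOn_setEdge_false {d : ℕ} (ω : Config d) {R O : Finset (EdgeD d)} {e : EdgeD d}
    (he : e ∉ R) (hO : O ⊆ R) : setOn (setEdge ω e false) R O = setOn ω (insert e R) O := by
  funext e'
  by_cases h : e' = e
  · subst h
    have : e' ∉ O := fun h => he (hO h)
    simp [setOn, he, this]
  · simp [setOn, h]

theorem IsBernoulli.integral_setOn {d : ℕ} {p : ℝ} {μ : Measure (Config d)}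
    (hμ : IsBernoulli d p μ) (hp0 : 0 ≤ p) (hp1 : p ≤ 1) {ψ : Config d → ℝ}
    {B : Finset (EdgeD d)} (hψ : DependsOn ψ (B : Set (EdgeD d))) (R : Finset (EdgeD d)) :
    ∫ ω, ψ ω ∂μ = ∫ ω, ∑ O ∈ R.powerset, subsetWeight p R O * ψ (setOn ω R O) ∂μ := by
  induction R using Finset.induction_on with
  | empty =>
    have h : ∀ ω : Config d, setOn ω ∅ ∅ = ω := fun ω => by funext e; simp [setOn]
    simp [subsetWeight, h]
  | insert e R he ih =>
    have hdep : DependsOn (fun ω => ∑ O ∈ R.powerset, subsetWeight p R O * ψ (setOn ω R O))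
        (B : Set (EdgeD d)) :=
      dependsOn_sum fun O _ => dependsOn_comp (dependsOn_setOn hψ R O) fun x =>
        subsetWeight p R O * x
    rw [ih, hμ.integral_resampleMean hp0 hp1 e hdep]
    refine integral_congr_ae (Filter.Eventually.of_forall fun ω => ?_)
    simp only [resampleMean]
    rw [sum_powerset_insert_subsetWeight he fun O => ψ (setOn ω (insert e R) O), Finset.mul_sum,
      Finset.mul_sum, ← Finset.sum_add_distrib]
    refine Finset.sum_congr rfl fun O hO => ?_
    rw [setOn_setEdge_true ω he, setOn_setEdge_false ω he (Finset.mem_powerset.1 hO)]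
    ring

/-- The number of edges of `R` which, when opened alone in `R`, give a strictly smaller value of
`T` than any edge of `R` open in `ω` does. -/
def pivotCount {d : ℕ} (T : Config d → ℝ) (R : Finset (EdgeD d)) (ω : Config d) : ℕ :=
  belowCount (fun e => T (setOn ω R {e})) R (R.filter fun e => ω e = true)

theorem dependsOn_pivotCount {d : ℕ} {T : Config d → ℝ} {B R : Finset (EdgeD d)}
    (hT : DependsOn T (B : Set (EdgeD d))) (hR : R ⊆ B) :
    DependsOn (pivotCount T R) (B : Set (EdgeD d)) := by
  intro ω ω' h
  have h1 : (R.filter fun e => ω e = true) = R.filter fun e => ω' e = true :=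
    Finset.filter_congr fun e he => by rw [h e (hR he)]
  have h2 : (fun e => T (setOn ω R {e})) = fun e => T (setOn ω' R {e}) :=
    funext fun e => dependsOn_setOn hT R {e} h
  rw [pivotCount, pivotCount, h1, h2]

theorem pivotCount_setOn {d : ℕ} {T : Config d → ℝ} {R O : Finset (EdgeD d)} (hO : O ⊆ R)
    (ω : Config d) :
    pivotCount T R (setOn ω R O) = belowCount (fun e => T (setOn ω R {e})) R O := by
  have : (R.filter fun e => setOn ω R O e = true) = O := by
    ext e
    rw [Finset.mem_filter]
    constructor
    · rintro ⟨h1, h2⟩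
      simpa [setOn, h1] using h2
    · intro h
      simp [setOn, hO h, h]
  rw [pivotCount, this]
  simp only [setOn_setOn]

theorem IsBernoulli.exists_integral_pivotCount_le {d : ℕ} {p : ℝ} {μ : Measure (Config d)}
    (hμ : IsBernoulli d p μ) (hp0 : 0 < p) (hp1 : p < 1) :
    ∃ C : ℝ, 0 < C ∧ ∀ (T : Config d → ℝ) (B R : Finset (EdgeD d)),
      DependsOn T (B : Set (EdgeD d)) → R ⊆ B →
        ∫ ω, (pivotCount T R ω : ℝ) ^ 4 ∂μ ≤ C := by
  have := hμ.1
  obtain ⟨C, hC0, hC⟩ := exists_sum_subsetWeight_belowCount_le hp0 hp1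
  refine ⟨C, hC0, fun T B R hT hR => ?_⟩
  have hdep : DependsOn (fun ω => (pivotCount T R ω : ℝ) ^ 4) (B : Set (EdgeD d)) :=
    dependsOn_comp (dependsOn_pivotCount hT hR) fun k : ℕ => (k : ℝ) ^ 4
  rw [hμ.integral_setOn hp0.le hp1.le hdep R]
  refine (integral_mono (g := fun _ => C) ?_ (integrable_const _) fun ω => ?_).trans (by simp)
  · exact integrable_of_dependsOn (B := B) (dependsOn_sum fun O _ =>
      dependsOn_comp (dependsOn_setOn hdep R O) fun x => subsetWeight p R O * x)
  · refine le_trans (le_of_eq (Finset.sum_congr rfl fun O hO => ?_))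
      (hC (fun e => T (setOn ω R {e})) R)
    rw [pivotCount_setOn (Finset.mem_powerset.1 hO)]

namespace Certified

variable {d : ℕ} {T : Config d → ℝ} {E : Config d → Finset (EdgeD d)} {L : ℝ}

/-- The closed edges of `B` whose opening decreases `T`. -/
def closedPivotal (T : Config d → ℝ) (B : Finset (EdgeD d)) (ω : Config d) : Finset (EdgeD d) :=
  B.filter fun e => ω e = false ∧ T (setEdge ω e true) < T ω

theorem setOn_lt_of_closedPivotal (h : Certified T E L) {B R : Finset (EdgeD d)} {ω : Config d}
    {e : EdgeD d} (he : e ∈ closedPivotal T B ω)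
    (heR : e ∈ R) (hR : ∀ b ∈ R, b ∈ E (setEdge ω e true) → b = e) {e' : EdgeD d}
    (he' : ω e' = true) : T (setOn ω R {e}) < T (setOn ω R {e'}) := by
  have he := (Finset.mem_filter.1 he).2
  calc T (setOn ω R {e}) ≤ T (setEdge ω e true) := h.cert _ _ fun b hb hbo => by
        by_cases hbR : b ∈ R
        · simp [setOn, hR b hbR hb, heR]
        · by_cases hbe : b = e
          · exact absurd (hbe ▸ heR) hbR
          · rw [setEdge_of_ne _ hbe] at hbo
            simp [setOn, hbR, hbo]
    _ < T ω := he.2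
    _ ≤ T (setOn ω R {e'}) := h.anti fun b hb => by
        by_cases hbR : b ∈ R
        · simp [setOn, hbR] at hb
          rwa [hb]
        · simpa [setOn, hbR] using hb

theorem influence_closed_le (h : Certified T E L) (ω : Config d) (e : EdgeD d) :
    (if ω e = true then 0 else influence T e ω) ≤
      if ω e = false ∧ T (setEdge ω e true) < T ω then L else 0 := by
  by_cases ho : ω e = true
  · simp [ho]
  · have hf : ω e = false := by simpa using ho
    have hself : setEdge ω e false = ω := by rw [← hf]; exact Function.update_eq_self ..
    rw [if_neg ho]
    split_ifs with hc
    · exact h.influence_le ω e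
    · rw [h.influence_eq, hself]
      have : ¬ T (setEdge ω e true) < T ω := fun hh => hc ⟨hf, hh⟩
      linarith

theorem sum_influence_le (h : Certified T E L) (hL : 0 ≤ L) (B : Finset (EdgeD d)) {w : ℕ}
    (hw : ∀ ω, (E ω).card ≤ w) (ω : Config d) :
    ∑ e ∈ B, influence T e ω ≤ L * w + L * (closedPivotal T B ω).card := by
  have h1 : ∀ e, influence T e ω ≤ (if e ∈ E ω then L else 0) +
      if ω e = false ∧ T (setEdge ω e true) < T ω then L else 0 := fun e => by
    have h2 := h.influence_open_le hL ω e
    have h3 := h.influence_closed_le ω e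
    by_cases ho : ω e = true
    · rw [if_pos ho] at h2
      refine h2.trans (le_add_of_nonneg_right ?_)
      split_ifs <;> [exact hL; exact le_rfl]
    · rw [if_neg ho] at h2 h3
      linarith
  refine (Finset.sum_le_sum fun e _ => h1 e).trans ?_
  rw [Finset.sum_add_distrib]
  refine add_le_add ?_ ?_
  · rw [← Finset.sum_filter, Finset.sum_const, nsmul_eq_mul, mul_comm]
    refine mul_le_mul_of_nonneg_left ?_ hL
    exact_mod_cast (Finset.card_le_card fun x hx => (Finset.mem_filter.1 hx).2).trans (hw ω)
  · rw [← Finset.sum_filter, Finset.sum_const, nsmul_eq_mul, mul_comm]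
    rfl

theorem card_closedPivotal_le (h : Certified T E L) (B : Finset (EdgeD d)) {w : ℕ} (hw1 : 1 ≤ w)
    (hw : ∀ ω, (E ω).card ≤ w) (ω : Config d) :
    ((closedPivotal T B ω).card : ℝ) ≤
      4 * w * ∑ R ∈ B.powerset, subsetWeight (1 / (2 * w)) B R * pivotCount T R ω := by
  have hw' : (1 : ℝ) ≤ w := by exact_mod_cast hw1
  have hθ1 : 1 / (2 * (w : ℝ)) ≤ 1 := by rw [div_le_one (by positivity)]; linarith
  calc ((closedPivotal T B ω).card : ℝ) = ∑ e ∈ closedPivotal T B ω, (1 : ℝ) := by simp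
    _ ≤ ∑ e ∈ closedPivotal T B ω, 4 * (w : ℝ) * ∑ R ∈ B.powerset,
          subsetWeight (1 / (2 * w)) B R *
            if e ∈ R ∧ (∀ b ∈ R, b ∈ E (setEdge ω e true) → b = e) then 1 else 0 :=
        Finset.sum_le_sum fun e he =>
          one_le_sum_subsetWeight_inter hw1 (Finset.mem_filter.1 he).1 (hw _)
    _ = 4 * w * ∑ R ∈ B.powerset, subsetWeight (1 / (2 * w)) B R *
          ∑ e ∈ closedPivotal T B ω,
            if e ∈ R ∧ (∀ b ∈ R, b ∈ E (setEdge ω e true) → b = e) then 1 else 0 := by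
        rw [← Finset.mul_sum, Finset.sum_comm]
        simp only [Finset.mul_sum]
    _ ≤ _ := by
        refine mul_le_mul_of_nonneg_left (Finset.sum_le_sum fun R _ => ?_) (by positivity)
        refine mul_le_mul_of_nonneg_left ?_ (subsetWeight_nonneg (by positivity) hθ1 _ _)
        rw [← Finset.sum_filter, Finset.sum_const, nsmul_eq_mul, mul_one, Nat.cast_le]
        refine Finset.card_le_card fun e he => ?_
        rw [Finset.mem_filter] at he
        refine Finset.mem_filter.2 ⟨he.2.1, fun e' he' => ?_⟩
        rw [Finset.mem_filter] at he'
        exact h.setOn_lt_of_closedPivotal he.1 he.2.1 he.2.2 he'.2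

theorem sum_influence_pow_four_le (h : Certified T E L) (hL : 0 ≤ L) (B : Finset (EdgeD d)) {w : ℕ}
    (hw1 : 1 ≤ w) (hw : ∀ ω, (E ω).card ≤ w) (ω : Config d) :
    (∑ e ∈ B, influence T e ω) ^ 4 ≤ 8 * (L * w) ^ 4 * (1 + 256 *
      ∑ R ∈ B.powerset, subsetWeight (1 / (2 * w)) B R * (pivotCount T R ω : ℝ) ^ 4) := by
  have hw' : (1 : ℝ) ≤ w := by exact_mod_cast hw1
  have hθ1 : 1 / (2 * (w : ℝ)) ≤ 1 := by rw [div_le_one (by positivity)]; linarith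
  set A := ∑ R ∈ B.powerset, subsetWeight (1 / (2 * w)) B R * (pivotCount T R ω : ℝ) with hA
  have hA0 : 0 ≤ A := Finset.sum_nonneg fun R _ =>
    mul_nonneg (subsetWeight_nonneg (by positivity) hθ1 _ _) (Nat.cast_nonneg _)
  have h1 : ∑ e ∈ B, influence T e ω ≤ L * w * (1 + 4 * A) := by
    refine (h.sum_influence_le hL B hw ω).trans ?_
    have := mul_le_mul_of_nonneg_left (h.card_closedPivotal_le B hw1 hw ω) hL
    linarith
  have h2 : A ^ 4 ≤ ∑ R ∈ B.powerset, subsetWeight (1 / (2 * w)) B R *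
      (pivotCount T R ω : ℝ) ^ 4 :=
    Real.pow_arith_mean_le_arith_mean_pow _ _ _
      (fun R _ => subsetWeight_nonneg (by positivity) hθ1 _ _) (sum_subsetWeight _ B)
      (fun R _ => Nat.cast_nonneg _) 4
  have h3 : (1 + 4 * A) ^ 4 ≤ 8 * (1 + 256 * A ^ 4) := by
    have := add_pow_le (zero_le_one (α := ℝ)) (by positivity : 0 ≤ 4 * A) 4
    norm_num at this
    nlinarith
  calc (∑ e ∈ B, influence T e ω) ^ 4 ≤ (L * w * (1 + 4 * A)) ^ 4 :=
        pow_le_pow_left₀ (Finset.sum_nonneg fun e _ => influence_nonneg T e ω) h1 4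
    _ = (L * w) ^ 4 * (1 + 4 * A) ^ 4 := by ring
    _ ≤ (L * w) ^ 4 * (8 * (1 + 256 * A ^ 4)) := by gcongr
    _ = 8 * (L * w) ^ 4 * (1 + 256 * A ^ 4) := by ring
    _ ≤ _ := by gcongr

end Certified

theorem IsBernoulli.exists_integral_sum_influence_pow_four_le {d : ℕ} {p : ℝ}
    {μ : Measure (Config d)} (hμ : IsBernoulli d p μ) (hp0 : 0 < p) (hp1 : p < 1) :
    ∃ C : ℝ, 0 < C ∧ ∀ (T : Config d → ℝ) (E : Config d → Finset (EdgeD d)) (L : ℝ) (w : ℕ)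
      (B : Finset (EdgeD d)), Certified T E L → 0 ≤ L → 1 ≤ w → (∀ ω, (E ω).card ≤ w) →
        DependsOn T (B : Set (EdgeD d)) →
          ∫ ω, (∑ e ∈ B, influence T e ω) ^ 4 ∂μ ≤ C * (L * w) ^ 4 := by
  have := hμ.1
  obtain ⟨C, hC0, hC⟩ := hμ.exists_integral_pivotCount_le hp0 hp1
  refine ⟨8 * (1 + 256 * C), by positivity, fun T E L w B h hL hw1 hw hT => ?_⟩
  have hw' : (1 : ℝ) ≤ w := by exact_mod_cast hw1
  have hθ1 : 1 / (2 * (w : ℝ)) ≤ 1 := by rw [div_le_one (by positivity)]; linarith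
  have hdep : ∀ R ∈ B.powerset, Integrable (fun ω =>
      subsetWeight (1 / (2 * w)) B R * (pivotCount T R ω : ℝ) ^ 4) μ := fun R hR =>
    (integrable_of_dependsOn (dependsOn_comp (dependsOn_pivotCount hT (Finset.mem_powerset.1 hR))
      fun k : ℕ => (k : ℝ) ^ 4)).const_mul _
  refine (integral_mono (integrable_of_dependsOn (B := B) ?_) ?_
    (h.sum_influence_pow_four_le hL B hw1 hw)).trans ?_
  · exact dependsOn_comp (dependsOn_sum fun e _ => dependsOn_influence hT e) fun x => x ^ 4
  · exact ((integrable_const _).add ((integrable_finsetSum _ hdep).const_mul _)).const_mul _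
  · rw [integral_const_mul, integral_add (integrable_const _)
      ((integrable_finsetSum _ hdep).const_mul _), integral_const_mul, integral_finsetSum _ hdep]
    have h1 : ∑ R ∈ B.powerset, ∫ ω, subsetWeight (1 / (2 * w)) B R *
        (pivotCount T R ω : ℝ) ^ 4 ∂μ ≤ C := by
      calc _ ≤ ∑ R ∈ B.powerset, subsetWeight (1 / (2 * w)) B R * C := by
            refine Finset.sum_le_sum fun R hR => ?_
            rw [integral_const_mul]
            exact mul_le_mul_of_nonneg_left (hC T B R hT (Finset.mem_powerset.1 hR))
              (subsetWeight_nonneg (by positivity) hθ1 _ _)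
        _ = C := by rw [← Finset.sum_mul, sum_subsetWeight, one_mul]
    have h2 : ∫ _ω : Config d, (1 : ℝ) ∂μ = 1 := by simp
    rw [h2]
    calc _ ≤ 8 * (L * w) ^ 4 * (1 + 256 * C) := by gcongr
      _ = _ := by ring

theorem pc_nonneg (d : ℕ) : 0 ≤ pc d :=
  Real.sSup_nonneg fun _ hp => hp.1

theorem norm1_ptE1_le (d n : ℕ) (z : ZVec d) : norm1 d (z - (z + ptE1 d n)) ≤ n := by
  rw [sub_add_cancel_left]
  cases d with
  | zero => simp [norm1]
  | succ d => simp [norm1, Fin.sum_univ_succ, ptE1]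

theorem card_boxFinset (d m : ℕ) : (boxFinset d m).card = (2 * m + 1) ^ d := by
  rw [boxFinset, Pi.card_Icc]
  simp only [Int.card_Icc, Finset.prod_const, Finset.card_univ, Fintype.card_fin]
  congr 1
  omega

theorem card_boxFinset_pos (d m : ℕ) : (0 : ℝ) < (boxFinset d m).card := by
  rw [card_boxFinset]
  positivity

theorem exists_dependsOn_passageTime_box {d n : ℕ} (hn0 : 0 < Real.log n) (m : ℕ) (y : ZVec d) :
    ∃ B : Finset (EdgeD d), ∀ z ∈ boxFinset d m,
      DependsOn (fun ω => passageTime d n ω z (z + y)) (B : Set (EdgeD d)) := by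
  choose B _ hB using fun z : ZVec d => exists_dependsOn_passageTime hn0 z (z + y)
  refine ⟨(boxFinset d m).biUnion B, fun z hz => ?_⟩
  exact (hB z).mono (by exact_mod_cast Finset.subset_biUnion_of_mem B hz)

theorem dependsOn_Fm {d n : ℕ} {B : Finset (EdgeD d)} (hB : ∀ z ∈ boxFinset d (mOf n),
    DependsOn (fun ω => passageTime d n ω z (z + ptE1 d n)) (B : Set (EdgeD d))) :
    DependsOn (Fm d n) (B : Set (EdgeD d)) :=
  dependsOn_comp (dependsOn_sum hB) fun x => x / (boxFinset d (mOf n)).card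

theorem influence_Fm_le {d : ℕ} (n : ℕ) (e : EdgeD d) (ω : Config d) :
    influence (Fm d n) e ω ≤ (∑ z ∈ boxFinset d (mOf n),
      influence (fun ω => passageTime d n ω z (z + ptE1 d n)) e ω) /
        (boxFinset d (mOf n)).card := by
  have h0 := card_boxFinset_pos d (mOf n)
  unfold influence Fm
  rw [← sub_div, abs_div, abs_of_pos h0, ← Finset.sum_sub_distrib]
  gcongr
  exact Finset.abs_sum_le_sum_abs _ _

theorem influence_Fm_le_log_sq {d n : ℕ} (hn : 1 ≤ Real.log n ^ 2) (hn0 : 0 < Real.log n)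
    (e : EdgeD d) (ω : Config d) : influence (Fm d n) e ω ≤ Real.log n ^ 2 := by
  refine (influence_Fm_le n e ω).trans ?_
  rw [div_le_iff₀ (card_boxFinset_pos d _), mul_comm, ← nsmul_eq_mul]
  exact Finset.sum_le_card_nsmul _ _ _ fun z _ =>
    (certified_passageTime hn hn0 z (z + ptE1 d n)).influence_le ω e

theorem IsBernoulli.integral_influence_Fm_le {d n : ℕ} {p : ℝ} {μ : Measure (Config d)}
    (hμ : IsBernoulli d p μ) (hp0 : 0 < p) (hp1 : p ≤ 1) (hn : 1 ≤ Real.log n ^ 2)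
    (hn0 : 0 < Real.log n) (e : EdgeD d) :
    ∫ ω, influence (Fm d n) e ω ∂μ ≤
      2 * d / p * (Real.log n ^ 2) ^ 2 * (mOf n + 1) / (2 * mOf n + 1) ^ d := by
  have := hμ.1
  obtain ⟨B, hB⟩ := exists_dependsOn_passageTime_box hn0 (mOf n) (ptE1 d n)
  have hint : ∀ z ∈ boxFinset d (mOf n), Integrable (fun ω =>
      influence (fun ω => passageTime d n ω z (z + ptE1 d n)) e ω) μ := fun z hz =>
    integrable_of_dependsOn (dependsOn_influence (hB z hz) e)
  calc ∫ ω, influence (Fm d n) e ω ∂μ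
      ≤ ∫ ω, (∑ z ∈ boxFinset d (mOf n),
          influence (fun ω => passageTime d n ω z (z + ptE1 d n)) e ω) /
            (boxFinset d (mOf n)).card ∂μ :=
        integral_mono (integrable_of_dependsOn (dependsOn_influence (dependsOn_Fm hB) e))
          ((integrable_finsetSum _ hint).div_const _) (influence_Fm_le n e)
    _ = (∑ z ∈ boxFinset d (mOf n),
          ∫ ω, influence (fun ω => passageTime d n ω z (z + ptE1 d n)) e ω ∂μ) /
            (boxFinset d (mOf n)).card := by
        rw [integral_div, integral_finsetSum _ hint]
    _ ≤ 2 * d / p * (Real.log n ^ 2) ^ 2 * (mOf n + 1) / (boxFinset d (mOf n)).card := by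
        gcongr
        exact hμ.sum_integral_influence_le hp0 hp1 hn hn0 (ptE1 d n) (mOf n) e
    _ = _ := by rw [card_boxFinset]; push_cast; rfl

theorem sum_influence_Fm_pow_four_le {d n : ℕ} (B : Finset (EdgeD d)) (ω : Config d) :
    (∑ e ∈ B, influence (Fm d n) e ω) ^ 4 ≤ (∑ z ∈ boxFinset d (mOf n),
      (∑ e ∈ B, influence (fun ω => passageTime d n ω z (z + ptE1 d n)) e ω) ^ 4) /
        (boxFinset d (mOf n)).card := by
  have h0 := card_boxFinset_pos d (mOf n)
  have h1 : ∑ e ∈ B, influence (Fm d n) e ω ≤ ∑ z ∈ boxFinset d (mOf n),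
      (1 / ((boxFinset d (mOf n)).card : ℝ)) *
        ∑ e ∈ B, influence (fun ω => passageTime d n ω z (z + ptE1 d n)) e ω := by
    refine (Finset.sum_le_sum fun e _ => influence_Fm_le n e ω).trans (le_of_eq ?_)
    rw [← Finset.mul_sum, Finset.sum_comm, ← Finset.sum_div]
    ring
  refine (pow_le_pow_left₀ (Finset.sum_nonneg fun e _ => influence_nonneg _ e ω) h1 4).trans ?_
  refine (Real.pow_arith_mean_le_arith_mean_pow _ _ _ (fun z _ => by positivity) ?_
    (fun z _ => Finset.sum_nonneg fun e _ => influence_nonneg _ e ω) 4).trans (le_of_eq ?_)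
  · rw [Finset.sum_const, nsmul_eq_mul]
    field_simp
  · rw [← Finset.mul_sum]
    ring

theorem card_pathEdges_geoPath_le {d n : ℕ} (hn : 1 ≤ Real.log n ^ 2) (hn0 : 0 < Real.log n)
    (ω : Config d) (z : ZVec d) :
    (pathEdges (geoPath d n ω z (z + ptE1 d n))).card ≤ ⌈(n : ℝ) * Real.log n ^ 2⌉₊ := by
  have h := mul_length_geoPath_le hn0 le_rfl hn hn le_rfl ω z (z + ptE1 d n)
  have h1 : ((norm1 d (z - (z + ptE1 d n)) : ℕ) : ℝ) ≤ n := by exact_mod_cast norm1_ptE1_le d n z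
  have h2 := (card_pathEdges_le (geoPath d n ω z (z + ptE1 d n)))
  have h3 : (((geoPath d n ω z (z + ptE1 d n)).length - 1 : ℕ) : ℝ) ≤ n * Real.log n ^ 2 := by
    nlinarith
  exact h2.trans (by exact_mod_cast h3.trans (Nat.le_ceil _))

theorem IsBernoulli.exists_integral_sum_influence_Fm_pow_four_le {d : ℕ} {p : ℝ}
    {μ : Measure (Config d)} (hμ : IsBernoulli d p μ) (hp0 : 0 < p) (hp1 : p < 1) :
    ∃ C : ℝ, 0 < C ∧ ∀ (n : ℕ) (B : Finset (EdgeD d)), 1 ≤ Real.log n ^ 2 → 0 < Real.log n →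
      (∀ z ∈ boxFinset d (mOf n),
        DependsOn (fun ω => passageTime d n ω z (z + ptE1 d n)) (B : Set (EdgeD d))) →
      ∫ ω, (∑ e ∈ B, influence (Fm d n) e ω) ^ 4 ∂μ ≤ C * (n * (Real.log n ^ 2) ^ 2) ^ 4 := by
  have := hμ.1
  obtain ⟨C, hC0, hC⟩ := hμ.exists_integral_sum_influence_pow_four_le hp0 hp1
  refine ⟨C * 16, by positivity, fun n B hn hn0 hB => ?_⟩
  have h0 := card_boxFinset_pos d (mOf n)
  have hn1 : (1 : ℝ) ≤ n := by
    rcases Nat.eq_zero_or_pos n with rfl | h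
    · simp at hn0
    · exact_mod_cast h
  set w := ⌈(n : ℝ) * Real.log n ^ 2⌉₊ with hw
  have hx : 1 ≤ (n : ℝ) * Real.log n ^ 2 := one_le_mul_of_one_le_of_one_le hn1 hn
  have hw1 : 1 ≤ w := Nat.one_le_iff_ne_zero.2 (by positivity)
  have hw2 : (w : ℝ) ≤ 2 * (n * Real.log n ^ 2) := by
    have := (Nat.ceil_lt_add_one (zero_le_one.trans hx)).le
    linarith
  have hdep : ∀ z ∈ boxFinset d (mOf n), Integrable (fun ω =>
      (∑ e ∈ B, influence (fun ω => passageTime d n ω z (z + ptE1 d n)) e ω) ^ 4) μ := fun z hz =>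
    integrable_of_dependsOn (B := B) (dependsOn_comp (dependsOn_sum fun e _ =>
      dependsOn_influence (hB z hz) e) fun x => x ^ 4)
  calc ∫ ω, (∑ e ∈ B, influence (Fm d n) e ω) ^ 4 ∂μ
      ≤ ∫ ω, (∑ z ∈ boxFinset d (mOf n),
          (∑ e ∈ B, influence (fun ω => passageTime d n ω z (z + ptE1 d n)) e ω) ^ 4) /
            (boxFinset d (mOf n)).card ∂μ :=
        integral_mono (integrable_of_dependsOn (B := B) (dependsOn_comp (dependsOn_sum fun e _ =>
          dependsOn_influence (dependsOn_Fm hB) e) fun x => x ^ 4))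
          ((integrable_finsetSum _ hdep).div_const _) (sum_influence_Fm_pow_four_le B)
    _ = (∑ z ∈ boxFinset d (mOf n), ∫ ω,
          (∑ e ∈ B, influence (fun ω => passageTime d n ω z (z + ptE1 d n)) e ω) ^ 4 ∂μ) /
            (boxFinset d (mOf n)).card := by
        rw [integral_div, integral_finsetSum _ hdep]
    _ ≤ C * (Real.log n ^ 2 * w) ^ 4 := by
        rw [div_le_iff₀ h0, mul_comm, ← nsmul_eq_mul]
        exact Finset.sum_le_card_nsmul _ _ _ fun z hz => hC _ _ _ w B
          (certified_passageTime hn hn0 z (z + ptE1 d n)) (sq_nonneg _) hw1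
          (fun ω => card_pathEdges_geoPath_le hn hn0 ω z) (hB z hz)
    _ ≤ C * (Real.log n ^ 2 * (2 * (n * Real.log n ^ 2))) ^ 4 := by gcongr
    _ = _ := by ring

theorem mul_le_truncation_add {Y N K L : ℝ} (hK : 0 < K) (hY : 0 ≤ Y) (hN : 0 ≤ N)
    (hYL : Y ≤ L) : Y * N ≤ K * Y + L / K ^ 3 * N ^ 4 := by
  have hL : 0 ≤ L := hY.trans hYL
  rcases le_total N K with h | h
  · have h1 : 0 ≤ L / K ^ 3 * N ^ 4 := by positivity
    have h2 := mul_le_mul_of_nonneg_left h hY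
    linarith
  · have h1 : N * K ^ 3 ≤ N ^ 4 := by
      calc N * K ^ 3 ≤ N * N ^ 3 := by gcongr
        _ = N ^ 4 := by ring
    have h2 : N ≤ N ^ 4 / K ^ 3 := by rwa [le_div_iff₀ (by positivity)]
    calc Y * N ≤ L * (N ^ 4 / K ^ 3) := by gcongr
      _ = L / K ^ 3 * N ^ 4 := by ring
      _ ≤ _ := le_add_of_nonneg_left (by positivity)

theorem IsBernoulli.integral_influence_Fm_mul_sum_le {d n : ℕ} {p : ℝ} {μ : Measure (Config d)}
    (hμ : IsBernoulli d p μ) (hn : 1 ≤ Real.log n ^ 2) (hn0 : 0 < Real.log n)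
    {B : Finset (EdgeD d)} (hB : DependsOn (Fm d n) (B : Set (EdgeD d))) (e : EdgeD d)
    {K : ℝ} (hK : 0 < K) :
    ∫ ω, influence (Fm d n) e ω * ∑ e' ∈ B, influence (Fm d n) e' ω ∂μ ≤
      K * ∫ ω, influence (Fm d n) e ω ∂μ +
        Real.log n ^ 2 / K ^ 3 * ∫ ω, (∑ e' ∈ B, influence (Fm d n) e' ω) ^ 4 ∂μ := by
  have := hμ.1
  have hY := dependsOn_influence hB e
  have hN : DependsOn (fun ω => ∑ e' ∈ B, influence (Fm d n) e' ω) (B : Set (EdgeD d)) :=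
    dependsOn_sum fun e' _ => dependsOn_influence hB e'
  have hY' := (integrable_of_dependsOn (μ := μ) hY).const_mul K
  have hN' := (integrable_of_dependsOn (μ := μ) (dependsOn_comp hN fun x => x ^ 4)).const_mul
    (Real.log n ^ 2 / K ^ 3)
  rw [← integral_const_mul, ← integral_const_mul, ← integral_add hY' hN']
  refine integral_mono (integrable_of_dependsOn (dependsOn_mul hY hN)) (hY'.add hN') fun ω => ?_
  exact mul_le_truncation_add hK (influence_nonneg _ e ω)
    (Finset.sum_nonneg fun e' _ => influence_nonneg _ e' ω) (influence_Fm_le_log_sq hn hn0 e ω)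

theorem rpow_le_mOf_add_one (n : ℕ) : (n : ℝ) ^ ((1 : ℝ) / 4) ≤ mOf n + 1 :=
  (Nat.lt_floor_add_one _).le

theorem mOf_ratio_le {d n : ℕ} (hd : 1 ≤ d) (hn : 0 < n) :
    ((mOf n : ℝ) + 1) / (2 * mOf n + 1) ^ d ≤ (n : ℝ) ^ (-(((d : ℝ) - 1) / 4)) := by
  have hn' : (0 : ℝ) < n := by exact_mod_cast hn
  obtain ⟨k, rfl⟩ : ∃ k, d = k + 1 := ⟨d - 1, by omega⟩
  have hm : (0 : ℝ) ≤ mOf n := Nat.cast_nonneg _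
  have h1 : (n : ℝ) ^ ((((k + 1 : ℕ) : ℝ) - 1) / 4) ≤ ((mOf n : ℝ) + 1) ^ k := by
    calc (n : ℝ) ^ ((((k + 1 : ℕ) : ℝ) - 1) / 4) = ((n : ℝ) ^ ((1 : ℝ) / 4)) ^ k := by
          rw [← Real.rpow_natCast, ← Real.rpow_mul hn'.le]
          congr 1
          push_cast
          ring
      _ ≤ _ := by gcongr; exact rpow_le_mOf_add_one n
  have h2 : (0 : ℝ) < (n : ℝ) ^ ((((k + 1 : ℕ) : ℝ) - 1) / 4) := Real.rpow_pos_of_pos hn' _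
  rw [Real.rpow_neg hn'.le]
  calc ((mOf n : ℝ) + 1) / (2 * mOf n + 1) ^ (k + 1)
      ≤ ((mOf n : ℝ) + 1) / (mOf n + 1) ^ (k + 1) := by
        gcongr
        linarith
    _ = (((mOf n : ℝ) + 1) ^ k)⁻¹ := by
        field_simp
        ring
    _ ≤ _ := by gcongr

theorem log_pow_eight_le (n : ℕ) (hn : 0 < n) :
    Real.log n ^ 8 ≤ 128 ^ 8 * (n : ℝ) ^ ((1 : ℝ) / 16) := by
  have hn' : (0 : ℝ) < n := by exact_mod_cast hn
  have h0 : 0 ≤ Real.log n := Real.log_natCast_nonneg n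
  have h1 := Real.log_le_rpow_div hn'.le (by norm_num : (0 : ℝ) < 1 / 128)
  calc Real.log n ^ 8 ≤ ((n : ℝ) ^ ((1 : ℝ) / 128) / (1 / 128)) ^ 8 := by gcongr
    _ = 128 ^ 8 * ((n : ℝ) ^ ((1 : ℝ) / 128)) ^ 8 := by ring
    _ = _ := by
      rw [← Real.rpow_natCast ((n : ℝ) ^ ((1 : ℝ) / 128)), ← Real.rpow_mul hn'.le]
      norm_num

theorem IsBernoulli.exists_integral_influence_Fm_mul_sum_le {d : ℕ} (hd : 2 ≤ d) {p : ℝ}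
    {μ : Measure (Config d)} (hμ : IsBernoulli d p μ) (hp0 : 0 < p) (hp1 : p < 1) :
    ∃ C : ℝ, 0 < C ∧ ∀ (n : ℕ) (B : Finset (EdgeD d)), 3 ≤ n →
      (∀ z ∈ boxFinset d (mOf n),
        DependsOn (fun ω => passageTime d n ω z (z + ptE1 d n)) (B : Set (EdgeD d))) →
      ∀ e, ∫ ω, influence (Fm d n) e ω * ∑ e' ∈ B, influence (Fm d n) e' ω ∂μ ≤
        C * (n : ℝ) ^ (((9 : ℝ) - d) / 8) := by
  obtain ⟨C, hC0, hC⟩ := hμ.exists_integral_sum_influence_Fm_pow_four_le hp0 hp1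
  refine ⟨(2 * d / p + C) * 128 ^ 8, by positivity, fun n B hn3 hB e => ?_⟩
  have hn' : (3 : ℝ) ≤ n := by exact_mod_cast hn3
  have hn0 : (0 : ℝ) < n := by linarith
  have hlog : 1 ≤ Real.log n := by
    rw [Real.le_log_iff_exp_le hn0]
    exact (Real.exp_one_lt_d9.le.trans (by norm_num)).trans hn'
  have hL : 1 ≤ Real.log n ^ 2 := one_le_pow₀ hlog
  have hlog0 : 0 < Real.log n := by linarith
  set s : ℝ := ((d : ℝ) - 1) / 16 with hs
  have hs1 : 1 / 16 ≤ s := by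
    have : (2 : ℝ) ≤ d := by exact_mod_cast hd
    rw [hs]
    linarith
  set a : ℝ := (n : ℝ) ^ s with ha
  have ha0 : 0 < a := Real.rpow_pos_of_pos hn0 _
  have hL0 : 0 < Real.log n ^ 2 := by positivity
  have hE : ∫ ω, influence (Fm d n) e ω ∂μ ≤ 2 * d / p * (Real.log n ^ 2) ^ 2 * (a ^ 4)⁻¹ := by
    refine (hμ.integral_influence_Fm_le hp0 hp1.le hL hlog0 e).trans ?_
    rw [mul_div_assoc]
    gcongr
    refine (mOf_ratio_le (by omega) (by omega)).trans (le_of_eq ?_)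
    rw [ha, ← Real.rpow_natCast, ← Real.rpow_mul hn0.le, ← Real.rpow_neg hn0.le, hs]
    congr 1
    push_cast
    ring
  have h4 := hC n B hL hlog0 hB
  have hlog8 : (Real.log n ^ 2) ^ 4 ≤ 128 ^ 8 * a := by
    calc (Real.log n ^ 2) ^ 4 = Real.log n ^ 8 := by ring
      _ ≤ _ := log_pow_eight_le n (by omega)
      _ ≤ _ := by
        gcongr
        exact Real.rpow_le_rpow_of_exponent_le (by linarith) hs1
  have hexp : (n : ℝ) ^ (((9 : ℝ) - d) / 8) = n * (a ^ 2)⁻¹ := by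
    rw [ha, ← Real.rpow_natCast, ← Real.rpow_mul hn0.le, ← Real.rpow_neg hn0.le]
    nth_rewrite 2 [← Real.rpow_one (n : ℝ)]
    rw [← Real.rpow_add hn0, hs]
    congr 1
    push_cast
    ring
  set L := Real.log n ^ 2 with hLdef
  have hK : 0 < n * L ^ 2 * a := by positivity
  refine (hμ.integral_influence_Fm_mul_sum_le hL hlog0 (dependsOn_Fm hB) e hK).trans ?_
  rw [hexp]
  calc _ ≤ n * L ^ 2 * a * (2 * d / p * L ^ 2 * (a ^ 4)⁻¹) +
        L / (n * L ^ 2 * a) ^ 3 * (C * (n * L ^ 2) ^ 4) := by gcongr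
    _ = (2 * d / p * L ^ 4 + C * L ^ 3) * (n * (a ^ 3)⁻¹) := by
        field_simp
    _ ≤ (2 * d / p * L ^ 4 + C * L ^ 4) * (n * (a ^ 3)⁻¹) := by
        gcongr
        norm_num
    _ = (2 * d / p + C) * L ^ 4 * (n * (a ^ 3)⁻¹) := by ring
    _ ≤ (2 * d / p + C) * (128 ^ 8 * a) * (n * (a ^ 3)⁻¹) := by gcongr
    _ = _ := by field_simp

/-- Proposition 4.6: bound on the total influence: there is `C > 0`
such that for all `λ`, `Σ_{i≥1} (E|Δ_i|)² ≤ C λ² E[e^{2λ F_m}] n^{(9−d)/8}`. -/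
theorem total_influence_bound
    (d : ℕ) (hd : 2 ≤ d) (p : ℝ) (hp : pc d < p) (hp1 : p < 1)
    (μ : Measure (Config d)) (hμ : IsBernoulli d p μ) (ε : ℕ ≃ EdgeD d) :
    ∃ C : ℝ, 0 < C ∧ ∀ n : ℕ, 2 ≤ n → ∀ lam : ℝ,
      ∑' i : ℕ, (∫⁻ ω, ENNReal.ofReal |mgDelta d n ε lam μ (i + 1) ω| ∂μ) ^ 2
        ≤ ENNReal.ofReal (C * lam ^ 2 * (n : ℝ) ^ (((9 : ℝ) - d) / 8)) *
          ∫⁻ ω, ENNReal.ofReal (Real.exp (2 * lam * Fm d n ω)) ∂μ := by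
  have hp0 : 0 < p := (pc_nonneg d).trans_lt hp
  obtain ⟨C, hC0, hC⟩ := hμ.exists_integral_influence_Fm_mul_sum_le hd hp0 hp1
  have hlog2 : 0 < Real.log (2 : ℕ) := Real.log_pos (by norm_num)
  obtain ⟨B₂, hB₂⟩ := exists_dependsOn_passageTime_box hlog2 (mOf 2) (ptE1 d 2)
  set q : EdgeD d → ℝ := fun e =>
    ∫ ω, influence (Fm d 2) e ω * ∑ e' ∈ B₂, influence (Fm d 2) e' ω ∂μ with hq
  have h2pos : (0 : ℝ) < ((2 : ℕ) : ℝ) ^ (((9 : ℝ) - d) / 8) := by positivity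
  set D : ℝ := (∑ e ∈ B₂, |q e|) / ((2 : ℕ) : ℝ) ^ (((9 : ℝ) - d) / 8) with hD
  have hD0 : 0 ≤ D := by positivity
  refine ⟨4 * (C + D), by positivity, fun n hn lam => ?_⟩
  have hn0 : (0 : ℝ) < (n : ℝ) ^ (((9 : ℝ) - d) / 8) :=
    Real.rpow_pos_of_pos (by exact_mod_cast (by omega : 0 < n)) _
  have hlog : 0 < Real.log n := Real.log_pos (by exact_mod_cast (by omega : 1 < n))
  have key : ∃ B : Finset (EdgeD d), DependsOn (Fm d n) (B : Set (EdgeD d)) ∧ ∀ e ∈ B,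
      ∫ ω, influence (Fm d n) e ω * ∑ e' ∈ B, influence (Fm d n) e' ω ∂μ ≤
        (C + D) * (n : ℝ) ^ (((9 : ℝ) - d) / 8) := by
    rcases hn.eq_or_lt with rfl | hn3
    · refine ⟨B₂, dependsOn_Fm hB₂, fun e he => ?_⟩
      have h1 : q e ≤ D * ((2 : ℕ) : ℝ) ^ (((9 : ℝ) - d) / 8) := by
        rw [hD, div_mul_cancel₀ _ h2pos.ne']
        exact (le_abs_self _).trans
          (Finset.single_le_sum (f := fun e => |q e|) (fun e _ => abs_nonneg _) he)
      have h2 := mul_pos hC0 h2pos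
      linarith
    · obtain ⟨B, hB⟩ := exists_dependsOn_passageTime_box hlog (mOf n) (ptE1 d n)
      refine ⟨B, dependsOn_Fm hB, fun e _ => (hC n B hn3 hB e).trans ?_⟩
      gcongr
      linarith
  obtain ⟨B, hB, hH⟩ := key
  refine (hμ.tsum_lintegral_increment_sq_le hp0.le hp1.le ε lam hB (by positivity) hH).trans
    (le_of_eq ?_)
  congr 2
  ring

end Perco
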